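/- arXiv:0909.2114 — 3 statements merged into one kernel-verified Lean document; each statement's English description precedes it below -/
import Mathlib

section
/- Let n ≥ 1, let Ā ∈ ℂ^{n×n}, and let σ > 0. Then the expectation of ‖A⁻¹‖² under the density ρ̃ is at most e(n+1)/(2σ²); equivalently, ∫_{ℂ^{n×n}} ‖A⁻¹‖² |det A|² ρ(A) dA ≤ (e(n+1)/(2σ²)) · ∫_{ℂ^{n×n}} |det A|² ρ(A) dA, where ‖A⁻¹‖ denotes the operator (spectral) norm of the inverse matrix (the integrand on the left being taken over the invertible matrices, which form a set of full measure). -/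
open MeasureTheory Matrix

/-- The operator (spectral) norm of a complex `n × n` matrix, i.e. the norm of the
induced linear map between Euclidean spaces. -/
noncomputable def matrixOpNorm {n : ℕ} (A : Matrix (Fin n) (Fin n) ℂ) : ℝ :=
  ‖LinearMap.toContinuousLinearMap (Matrix.toEuclideanLin A)‖

/-- The density of the Gaussian distribution `N(Ā, σ²I)` on `ℂ^{n×n} ≅ ℝ^{2n²}`. -/
noncomputable def matrixGaussianDensity {n : ℕ} (Abar : Matrix (Fin n) (Fin n) ℂ) (σ : ℝ)
    (A : Fin n → Fin n → ℂ) : ℝ :=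
  ((2 * Real.pi * σ ^ 2) ^ (n ^ 2))⁻¹ *
    Real.exp (-(∑ i, ∑ j, ‖A i j - Abar i j‖ ^ 2) / (2 * σ ^ 2))


noncomputable def gd (s : ℝ) (z : ℂ) : ℝ := (Real.pi * s)⁻¹ * Real.exp (-‖z‖ ^ 2 / s)

lemma gd_nonneg {s : ℝ} (hs : 0 < s) (z : ℂ) : 0 ≤ gd s z := by
  unfold gd; positivity

lemma gd_cont (s : ℝ) : Continuous (gd s) := by
  unfold gd; fun_prop

lemma gd_neg (s : ℝ) (z : ℂ) : gd s (-z) = gd s z := by simp [gd]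

lemma gd_int {s : ℝ} (hs : 0 < s) : ∫ z, gd s z = 1 := by
  have h := Complex.integral_rpow_mul_exp_neg_mul_rpow (p := 2) (q := 0) (b := s⁻¹) (by norm_num)
    (by norm_num) (by positivity)
  norm_num [Real.rpow_neg_one] at h
  unfold gd
  rw [integral_const_mul]
  have : ∀ z : ℂ, -‖z‖ ^ 2 / s = -(s⁻¹ * ‖z‖ ^ 2) := fun z => by ring
  simp_rw [this, h]
  have := Real.pi_pos
  field_simp

lemma gd_int2 {s : ℝ} (hs : 0 < s) : ∫ z, ‖z‖ ^ 2 * gd s z = s := by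
  have h := Complex.integral_rpow_mul_exp_neg_mul_rpow (p := 2) (q := 2) (b := s⁻¹) (by norm_num)
    (by norm_num) (by positivity)
  have h2 : (s⁻¹ : ℝ) ^ (-(2 + 2) / 2 : ℝ) = s ^ 2 := by
    rw [show (-(2 + 2) / 2 : ℝ) = -((2 : ℕ) : ℝ) by norm_num, Real.rpow_neg (by positivity),
      Real.rpow_natCast]; simp
  rw [h2, show ((2 : ℝ) + 2) / 2 = 2 by norm_num, Real.Gamma_two] at h
  norm_num at h
  unfold gd
  have : ∀ z : ℂ, ‖z‖ ^ 2 * ((Real.pi * s)⁻¹ * Real.exp (-‖z‖ ^ 2 / s)) =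
      (Real.pi * s)⁻¹ * (‖z‖ ^ 2 * Real.exp (-(s⁻¹ * ‖z‖ ^ 2))) := fun z => by
    rw [show -‖z‖ ^ 2 / s = -(s⁻¹ * ‖z‖ ^ 2) by ring]; ring
  simp_rw [this]
  rw [integral_const_mul, h]
  have := Real.pi_pos
  field_simp

lemma gd_integrable {s : ℝ} (hs : 0 < s) : Integrable (gd s) := by
  by_contra h
  have := gd_int hs
  rw [integral_undef h] at this
  norm_num at this

lemma gd_integrable2 {s : ℝ} (hs : 0 < s) : Integrable (fun z => ‖z‖ ^ 2 * gd s z) := by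
  by_contra h
  have := gd_int2 hs
  rw [integral_undef h] at this
  linarith

lemma one_dim {s : ℝ} (hs : 0 < s) (w c : ℂ) :
    Integrable (fun z => ‖w + c * z‖ ^ 2 * gd s z) ∧
    ∫ z, ‖w + c * z‖ ^ 2 * gd s z = ‖w‖ ^ 2 + s * ‖c‖ ^ 2 := by
  set r : ℂ → ℝ := fun z => 2 * (w * (starRingEnd ℂ) (c * z)).re with hr
  have hexp : ∀ z, ‖w + c * z‖ ^ 2 * gd s z =
      ‖w‖ ^ 2 * gd s z + ‖c‖ ^ 2 * (‖z‖ ^ 2 * gd s z) + r z * gd s z := fun z => by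
    rw [Complex.sq_norm, Complex.normSq_add, ← Complex.sq_norm, ← Complex.sq_norm, norm_mul]
    simp only [hr]; ring
  have i1 := (gd_integrable hs).const_mul (‖w‖ ^ 2)
  have i2 := (gd_integrable2 hs).const_mul (‖c‖ ^ 2)
  have i3 : Integrable (fun z => r z * gd s z) := by
    refine (i1.add i2).mono' ?_ (Filter.Eventually.of_forall fun z => ?_)
    · have := gd_cont s
      exact Continuous.aestronglyMeasurable (by fun_prop)
    · have hg := gd_nonneg hs z
      rw [norm_mul, Real.norm_eq_abs, Real.norm_of_nonneg hg]
      have : |r z| ≤ ‖w‖ ^ 2 + ‖c‖ ^ 2 * ‖z‖ ^ 2 := by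
        have h1 := Complex.abs_re_le_norm (w * (starRingEnd ℂ) (c * z))
        simp only [norm_mul, RCLike.norm_conj] at h1
        simp only [hr, abs_mul, abs_two]
        nlinarith [sq_nonneg (‖w‖ - ‖c‖ * ‖z‖)]
      calc _ ≤ (‖w‖ ^ 2 + ‖c‖ ^ 2 * ‖z‖ ^ 2) * gd s z := by gcongr
        _ = _ := by simp only [Pi.add_apply]; ring
  have h3 : ∫ z, r z * gd s z = 0 := by
    have h := integral_neg_eq_self (fun z => r z * gd s z) (volume : Measure ℂ)
    have h' : ∀ z, r (-z) * gd s (-z) = -(r z * gd s z) := fun z => by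
      rw [gd_neg]; simp only [hr, mul_neg, map_neg, Complex.neg_re]; ring
    simp_rw [h'] at h
    rw [integral_neg] at h
    linarith
  simp_rw [hexp]
  refine ⟨(i1.add i2).add i3, ?_⟩
  have e1 := integral_add (i1.add i2) i3
  simp only [Pi.add_apply] at e1
  rw [e1, integral_add i1 i2, h3, integral_const_mul, integral_const_mul,
    gd_int hs, gd_int2 hs]
  ring

lemma one_dim_l {s : ℝ} (hs : 0 < s) (m c a : ℂ) :
    ∫⁻ z, ENNReal.ofReal (‖m + c * z‖ ^ 2) * ENNReal.ofReal (gd s (z - a)) =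
      ENNReal.ofReal (‖m + c * a‖ ^ 2 + s * ‖c‖ ^ 2) := by
  have h := lintegral_sub_right_eq_self (μ := (volume : Measure ℂ))
    (fun z => ENNReal.ofReal (‖m + c * a + c * z‖ ^ 2) * ENNReal.ofReal (gd s z)) a
  have h' : ∀ z, m + c * a + c * (z - a) = m + c * z := fun z => by ring
  simp_rw [h'] at h
  rw [h]
  obtain ⟨i, e⟩ := one_dim hs (m + c * a) c
  rw [← e, ofReal_integral_eq_lintegral_ofReal i]
  · refine lintegral_congr fun z => ?_
    rw [ENNReal.ofReal_mul (by positivity)]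
  · exact Filter.Eventually.of_forall fun z => mul_nonneg (by positivity) (gd_nonneg hs z)

lemma gd_meas (s : ℝ) (a : ℂ) : Measurable (fun z => ENNReal.ofReal (gd s (z - a))) := by
  have := (gd_cont s).measurable
  fun_prop

noncomputable def Gd {n : ℕ} (s : ℝ) (a z : Fin n → ℂ) : ENNReal :=
  ∏ j, ENNReal.ofReal (gd s (z j - a j))

lemma Gd_meas {n : ℕ} (s : ℝ) (a : Fin n → ℂ) : Measurable (Gd s a) := by
  unfold Gd
  refine Finset.measurable_prod _ fun j _ => ?_
  exact (gd_meas s (a j)).comp (measurable_pi_apply j)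

lemma row {s : ℝ} (hs : 0 < s) (n : ℕ) : ∀ (m : ℂ) (c a : Fin n → ℂ),
    ∫⁻ z : Fin n → ℂ, ENNReal.ofReal (‖m + ∑ j, c j * z j‖ ^ 2) * Gd s a z =
      ENNReal.ofReal (‖m + ∑ j, c j * a j‖ ^ 2 + s * ∑ j, ‖c j‖ ^ 2) := by
  induction n with
  | zero => intro m c a; simp [Gd, volume_pi]
  | succ n ih =>
    intro m c a
    have hp := (volume_preserving_piFinSuccAbove (fun _ : Fin (n + 1) => ℂ) 0).symm
    rw [← hp.lintegral_comp_emb (MeasurableEquiv.measurableEmbedding _)]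
    have hm : Measurable fun z : Fin (n+1) → ℂ =>
        ENNReal.ofReal (‖m + ∑ j, c j * z j‖ ^ 2) * Gd s a z := by
      have := Gd_meas s a
      fun_prop
    rw [Measure.volume_eq_prod, lintegral_prod _ (by
      exact (hm.comp (MeasurableEquiv.measurable _)).aemeasurable)]
    simp only [MeasurableEquiv.piFinSuccAbove_symm_apply, Fin.insertNthEquiv_apply,
      Fin.insertNth_zero, Fin.sum_univ_succ, Gd, Fin.prod_univ_succ, Fin.cons_zero, Fin.cons_succ]
    have key : ∀ x : ℂ, ∫⁻ y : Fin n → ℂ,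
        ENNReal.ofReal (‖m + (c 0 * x + ∑ i, c (Fin.succ i) * y i)‖ ^ 2) *
          (ENNReal.ofReal (gd s (x - a 0)) *
            ∏ i, ENNReal.ofReal (gd s (y i - a (Fin.succ i)))) =
        ENNReal.ofReal (‖(m + ∑ i, c (Fin.succ i) * a (Fin.succ i)) + c 0 * x‖ ^ 2) *
          ENNReal.ofReal (gd s (x - a 0)) +
        ENNReal.ofReal (s * ∑ j, ‖c (Fin.succ j)‖ ^ 2) * ENNReal.ofReal (‖(1:ℂ) + 0 * x‖ ^ 2) *
          ENNReal.ofReal (gd s (x - a 0)) := fun x => by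
      have h := ih (m + c 0 * x) (fun j => c (Fin.succ j)) (fun j => a (Fin.succ j))
      have h2 : ∀ y : Fin n → ℂ, 
        ENNReal.ofReal (‖m + (c 0 * x + ∑ i, c (Fin.succ i) * y i)‖ ^ 2) *
          (ENNReal.ofReal (gd s (x - a 0)) *
            ∏ i, ENNReal.ofReal (gd s (y i - a (Fin.succ i)))) = 
          ENNReal.ofReal (gd s (x - a 0)) * (ENNReal.ofReal (‖(m + c 0 * x) + (∑ i, c (Fin.succ i) * y i)‖ ^ 2) *
            Gd s (fun j => a (Fin.succ j)) y) := fun y => by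
        rw [Gd, ← add_assoc]; ring
      simp_rw [h2]
      rw [lintegral_const_mul _ (by
        have := Gd_meas s (fun j => a (Fin.succ j))
        fun_prop), h, ENNReal.ofReal_add (by positivity) (by positivity),
        show m + c 0 * x + ∑ j, c (Fin.succ j) * a (Fin.succ j) =
          m + ∑ j, c (Fin.succ j) * a (Fin.succ j) + c 0 * x by ring]
      simp
      ring
    refine (lintegral_congr key).trans ?_
    have hg := gd_meas s (a 0)
    rw [lintegral_add_left (by fun_prop), one_dim_l hs]
    simp_rw [mul_assoc (ENNReal.ofReal (s * _))]
    rw [lintegral_const_mul _ (by fun_prop), one_dim_l hs, ← ENNReal.ofReal_mul (by positivity),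
      ← ENNReal.ofReal_add (by positivity) (by positivity)]
    congr 1
    rw [show m + ∑ i, c (Fin.succ i) * a (Fin.succ i) + c 0 * a 0 =
      m + (c 0 * a 0 + ∑ i, c (Fin.succ i) * a (Fin.succ i)) by ring]
    simp
    ring

lemma row_one {s : ℝ} (hs : 0 < s) {n : ℕ} (a : Fin n → ℂ) : ∫⁻ z, Gd s a z = 1 := by
  have := row hs n 1 0 a
  simpa using this

noncomputable def Wd {m n : ℕ} (s : ℝ) (a z : Fin m → Fin n → ℂ) : ENNReal :=
  ∏ i, Gd s (a i) (z i)

lemma Wd_meas {m n : ℕ} (s : ℝ) (a : Fin m → Fin n → ℂ) : Measurable (Wd s a) := by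
  unfold Wd
  refine Finset.measurable_prod _ fun j _ => ?_
  exact (Gd_meas s (a j)).comp (measurable_pi_apply j)

noncomputable def cof {n : ℕ} (i : Fin (n + 1)) (B : Fin n → Fin (n + 1) → ℂ) (j : Fin (n + 1)) : ℂ :=
  (-1) ^ ((i : ℕ) + (j : ℕ)) * (Matrix.of fun k l => B k (j.succAbove l)).det

lemma det_ins {n : ℕ} (i : Fin (n + 1)) (x : Fin (n + 1) → ℂ) (B : Fin n → Fin (n + 1) → ℂ) :
    (Matrix.of (i.insertNth (α := fun _ => Fin (n + 1) → ℂ) x B)).det = ∑ j, cof i B j * x j := by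
  rw [Matrix.det_succ_row _ i]
  refine Finset.sum_congr rfl fun j _ => ?_
  have : (Matrix.of (i.insertNth (α := fun _ => Fin (n + 1) → ℂ) x B)).submatrix
      i.succAbove j.succAbove = Matrix.of fun k l => B k (j.succAbove l) := by
    ext k l; simp
  rw [this]
  simp [cof]; ring

lemma Wd_ins {n m : ℕ} (s : ℝ) (a : Fin (n + 1) → Fin m → ℂ) (i : Fin (n + 1)) (x : Fin m → ℂ)
    (B : Fin n → Fin m → ℂ) :
    Wd s a (i.insertNth (α := fun _ => Fin m → ℂ) x B) =
      Gd s (a i) x * Wd s (fun k => a (i.succAbove k)) B := by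
  simp [Wd, Fin.prod_univ_succAbove _ i]

lemma adj_ins {n : ℕ} (i j : Fin (n + 1)) (x : Fin (n + 1) → ℂ) (B : Fin n → Fin (n + 1) → ℂ) :
    ‖(Matrix.of (i.insertNth (α := fun _ => Fin (n + 1) → ℂ) x B)).adjugate j i‖ = ‖cof i B j‖ := by
  rw [Matrix.adjugate_fin_succ_eq_det_submatrix, cof]
  have : (Matrix.of (i.insertNth (α := fun _ => Fin (n + 1) → ℂ) x B)).submatrix
      i.succAbove j.succAbove = Matrix.of fun k l => B k (j.succAbove l) := by
    ext k l; simp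
  rw [this]

lemma cof_cont {n : ℕ} (i j : Fin (n + 1)) : Continuous (fun B => cof (n := n) i B j) := by
  unfold cof
  refine continuous_const.mul (Continuous.matrix_det ?_)
  exact continuous_matrix fun k l => by simp only [Matrix.of_apply]; fun_prop

lemma det_cont {n : ℕ} : Continuous (fun A : Fin n → Fin n → ℂ => (Matrix.of A).det) :=
  Continuous.matrix_det (continuous_matrix fun k l => by simp only [Matrix.of_apply]; fun_prop)

lemma adj_cont {n : ℕ} (i j : Fin n) :
    Continuous (fun A : Fin n → Fin n → ℂ => (Matrix.of A).adjugate i j) := by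
  have : Continuous (fun A : Fin n → Fin n → ℂ => (Matrix.of A)) :=
    continuous_matrix fun k l => by simp only [Matrix.of_apply]; fun_prop
  exact this.matrix_adjugate.matrix_elem i j

lemma lint_ins {n m : ℕ} (i : Fin (n + 1)) (F : (Fin (n + 1) → Fin m → ℂ) → ENNReal)
    (hF : Measurable F) :
    ∫⁻ A, F A = ∫⁻ B : Fin n → Fin m → ℂ, ∫⁻ x : Fin m → ℂ,
      F (i.insertNth (α := fun _ => Fin m → ℂ) x B) := by
  have hp := (volume_preserving_piFinSuccAbove (fun _ : Fin (n + 1) => Fin m → ℂ) i).symm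
  rw [← hp.lintegral_comp_emb (MeasurableEquiv.measurableEmbedding _)]
  rw [Measure.volume_eq_prod, lintegral_prod_symm _ (by
      exact (hF.comp (MeasurableEquiv.measurable _)).aemeasurable)]
  rfl

lemma main_row {n : ℕ} {s : ℝ} (hs : 0 < s) (a : Fin (n + 1) → Fin (n + 1) → ℂ) (i : Fin (n + 1)) :
    ENNReal.ofReal s * ∫⁻ A : Fin (n + 1) → Fin (n + 1) → ℂ,
      ENNReal.ofReal (∑ j, ‖(Matrix.of A).adjugate j i‖ ^ 2) * Wd s a A ≤
    ∫⁻ A : Fin (n + 1) → Fin (n + 1) → ℂ,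
      ENNReal.ofReal (‖(Matrix.of A).det‖ ^ 2) * Wd s a A := by
  have hW := Wd_meas s a
  have hd : Measurable (fun A : Fin (n + 1) → Fin (n + 1) → ℂ => (Matrix.of A).det) :=
    det_cont.measurable
  have ha : ∀ i j, Measurable (fun A : Fin (n + 1) → Fin (n + 1) → ℂ => (Matrix.of A).adjugate i j) :=
    fun i j => (adj_cont i j).measurable
  have hc : ∀ j, Measurable (fun B => cof (n := n) i B j) := fun j => (cof_cont i j).measurable
  have hW' := Wd_meas s (fun k => a (i.succAbove k))
  have hG := Gd_meas s (a i)
  rw [lint_ins i _ (by fun_prop), lint_ins i _ (by fun_prop), ← lintegral_const_mul' _ _ (by simp)]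
  refine lintegral_mono fun B => ?_
  simp only [det_ins, adj_ins, Wd_ins]
  have h1 : ∀ x : Fin (n + 1) → ℂ, ENNReal.ofReal (‖∑ j, cof i B j * x j‖ ^ 2) *
      (Gd s (a i) x * Wd s (fun k => a (i.succAbove k)) B) = Wd s (fun k => a (i.succAbove k)) B *
      (ENNReal.ofReal (‖0 + ∑ j, cof i B j * x j‖ ^ 2) * Gd s (a i) x) := fun x => by
    rw [zero_add]; ring
  have h2 : ∀ x : Fin (n + 1) → ℂ, ENNReal.ofReal (∑ j, ‖cof i B j‖ ^ 2) *
      (Gd s (a i) x * Wd s (fun k => a (i.succAbove k)) B) = (ENNReal.ofReal (∑ j, ‖cof i B j‖ ^ 2) *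
      Wd s (fun k => a (i.succAbove k)) B) * Gd s (a i) x := fun x => by ring
  simp_rw [h1, h2]
  rw [lintegral_const_mul _ hG, lintegral_const_mul _ (by fun_prop), row hs, row_one hs, mul_one,
    ← mul_assoc, ← ENNReal.ofReal_mul hs.le, mul_comm]
  gcongr
  have := sq_nonneg ‖0 + ∑ j, cof i B j * a i j‖
  linarith

lemma opNorm_sq_le {n : ℕ} (M : Matrix (Fin n) (Fin n) ℂ) :
    matrixOpNorm M ^ 2 ≤ ∑ i, ∑ j, ‖M i j‖ ^ 2 := by
  have hnn : 0 ≤ ∑ i, ∑ j, ‖M i j‖ ^ 2 := by positivity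
  have : matrixOpNorm M ≤ √(∑ i, ∑ j, ‖M i j‖ ^ 2) := by
    refine ContinuousLinearMap.opNorm_le_bound _ (Real.sqrt_nonneg _) fun x => ?_
    rw [EuclideanSpace.norm_eq, EuclideanSpace.norm_eq, ← Real.sqrt_mul hnn]
    refine Real.sqrt_le_sqrt ?_
    rw [Finset.sum_mul]
    refine Finset.sum_le_sum fun i _ => ?_
    have h1 : ‖(LinearMap.toContinuousLinearMap (Matrix.toEuclideanLin M)) x i‖ ≤
        ∑ j, ‖M i j‖ * ‖x j‖ := by
      simp only [LinearMap.coe_toContinuousLinearMap', Matrix.toLpLin_apply, Matrix.mulVec, dotProduct]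
      refine (norm_sum_le _ _).trans (le_of_eq ?_)
      simp
    calc _ ≤ (∑ j, ‖M i j‖ * ‖x j‖) ^ 2 := by gcongr
      _ ≤ _ := Finset.sum_mul_sq_le_sq_mul_sq _ _ _
  calc _ ≤ (√(∑ i, ∑ j, ‖M i j‖ ^ 2)) ^ 2 := by
        gcongr; exact norm_nonneg _
    _ = _ := Real.sq_sqrt hnn

lemma inv_adj {n : ℕ} (M : Matrix (Fin n) (Fin n) ℂ) :
    matrixOpNorm M⁻¹ ^ 2 * ‖M.det‖ ^ 2 ≤ ∑ i, ∑ j, ‖M.adjugate j i‖ ^ 2 := by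
  by_cases h : M.det = 0
  · rw [h]; simp; positivity
  · calc _ ≤ (∑ i, ∑ j, ‖M⁻¹ i j‖ ^ 2) * ‖M.det‖ ^ 2 := by gcongr; exact opNorm_sq_le _
      _ = _ := by
        rw [Finset.sum_comm, Finset.sum_mul]
        refine Finset.sum_congr rfl fun i _ => ?_
        rw [Finset.sum_mul]
        refine Finset.sum_congr rfl fun j _ => ?_
        rw [Matrix.inv_def, Matrix.smul_apply, Ring.inverse_eq_inv', smul_eq_mul, norm_mul, norm_inv]
        have : ‖M.det‖ ≠ 0 := by simpa using h
        field_simp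

lemma dens_eq {n : ℕ} (Abar : Matrix (Fin n) (Fin n) ℂ) (σ : ℝ) (A : Fin n → Fin n → ℂ) :
    matrixGaussianDensity Abar σ A = ∏ i, ∏ j, gd (2 * σ ^ 2) (A i j - Abar i j) := by
  simp only [matrixGaussianDensity, gd, Finset.prod_mul_distrib, Finset.prod_const,
    ← Real.exp_sum, Finset.card_univ, Fintype.card_fin, ← pow_mul]
  congr 1
  · rw [inv_pow]; congr 2 <;> ring
  · simp_rw [neg_div, Finset.sum_neg_distrib, Finset.sum_div]

lemma dens_l {n : ℕ} (Abar : Matrix (Fin n) (Fin n) ℂ) (σ : ℝ) (hσ : 0 < σ) (A : Fin n → Fin n → ℂ) :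
    ENNReal.ofReal (matrixGaussianDensity Abar σ A) = Wd (2 * σ ^ 2) (fun i j => Abar i j) A := by
  have h : 0 < 2 * σ ^ 2 := by positivity
  rw [dens_eq, Wd, ENNReal.ofReal_prod_of_nonneg]
  · refine Finset.prod_congr rfl fun i _ => ?_
    rw [Gd, ENNReal.ofReal_prod_of_nonneg fun j _ => gd_nonneg h _]
  · exact fun i _ => Finset.prod_nonneg fun j _ => gd_nonneg h _

lemma det_bound {n : ℕ} (A : Fin n → Fin n → ℂ) :
    ‖(Matrix.of A).det‖ ^ 2 ≤ (n.factorial : ℝ) ^ 2 * ∏ i, ∏ j, (1 + ‖A i j‖) ^ 2 := by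
  have : ‖(Matrix.of A).det‖ ≤ (n.factorial : ℝ) * ∏ i, ∏ j, (1 + ‖A i j‖) := by
    rw [← Matrix.det_transpose, Matrix.det_apply]
    refine (norm_sum_le _ _).trans ?_
    have : ∀ p ∈ (Finset.univ : Finset (Equiv.Perm (Fin n))),
        ‖Equiv.Perm.sign p • ∏ i, (Matrix.of A)ᵀ (p i) i‖ ≤ ∏ i, ∏ j, (1 + ‖A i j‖) := fun p _ => by
      have e : ‖Equiv.Perm.sign p • ∏ i, (Matrix.of A)ᵀ (p i) i‖ = ∏ i, ‖A i (p i)‖ := by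
        rcases Int.units_eq_one_or (Equiv.Perm.sign p) with h | h <;> simp [h]
      rw [e]
      refine Finset.prod_le_prod (fun _ _ => norm_nonneg _) fun i _ => ?_
      rw [← Finset.mul_prod_erase _ _ (Finset.mem_univ (p i))]
      have h1 : (1 : ℝ) ≤ ∏ x ∈ Finset.univ.erase (p i), (1 + ‖A i x‖) := by
        have := Finset.prod_le_prod (s := Finset.univ.erase (p i)) (f := fun _ => (1 : ℝ))
          (g := fun x => 1 + ‖A i x‖) (fun _ _ => zero_le_one) (fun x _ => by
            have := norm_nonneg (A i x); linarith)
        simpa using this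
      nlinarith [norm_nonneg (A i (p i))]
    refine (Finset.sum_le_sum this).trans (le_of_eq ?_)
    simp [Fintype.card_perm]
  calc _ ≤ ((n.factorial : ℝ) * ∏ i, ∏ j, (1 + ‖A i j‖)) ^ 2 := by gcongr
    _ = _ := by simp only [mul_pow, Finset.prod_pow]

lemma gd_poly {s : ℝ} (hs : 0 < s) (a : ℂ) :
    Integrable (fun z => (1 + ‖z‖) ^ 2 * gd s (z - a)) := by
  have i1 := ((one_dim hs 1 0).1.comp_sub_right a).const_mul 2
  have i2 := ((one_dim hs a 1).1.comp_sub_right a).const_mul 2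
  refine (i1.add i2).mono' ?_ (Filter.Eventually.of_forall fun z => ?_)
  · have := gd_cont s
    exact Continuous.aestronglyMeasurable (by fun_prop)
  · have hg := gd_nonneg hs (z - a)
    rw [norm_mul, Real.norm_of_nonneg hg, Real.norm_of_nonneg (by positivity)]
    simp only [Pi.add_apply, zero_mul, add_zero, norm_one, one_mul, add_sub_cancel]
    nlinarith [mul_nonneg hg (sq_nonneg (1 - ‖z‖))]

lemma gauss_cont {n : ℕ} (Abar : Matrix (Fin n) (Fin n) ℂ) (σ : ℝ) :
    Continuous (matrixGaussianDensity Abar σ) := by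
  unfold matrixGaussianDensity; fun_prop

lemma det_integrable {n : ℕ} (Abar : Matrix (Fin n) (Fin n) ℂ) (σ : ℝ) (hσ : 0 < σ) :
    Integrable (fun A : Fin n → Fin n → ℂ =>
      ‖(Matrix.of A).det‖ ^ 2 * matrixGaussianDensity Abar σ A) := by
  have h : 0 < 2 * σ ^ 2 := by positivity
  have i1 : Integrable (fun A : Fin n → Fin n → ℂ =>
      ∏ i, ∏ j, ((1 + ‖A i j‖) ^ 2 * gd (2 * σ ^ 2) (A i j - Abar i j))) := by
    refine Integrable.fintype_prod (f := fun i (x : Fin n → ℂ) =>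
      ∏ j, ((1 + ‖x j‖) ^ 2 * gd (2 * σ ^ 2) (x j - Abar i j))) fun i => ?_
    exact Integrable.fintype_prod (f := fun j (z : ℂ) =>
      ((1 + ‖z‖) ^ 2 * gd (2 * σ ^ 2) (z - Abar i j))) fun j => gd_poly h _
  refine (i1.const_mul ((n.factorial : ℝ) ^ 2)).mono' ?_ (Filter.Eventually.of_forall fun A => ?_)
  · have := gauss_cont Abar σ
    have := det_cont (n := n)
    exact Continuous.aestronglyMeasurable (by fun_prop)
  · have hr : 0 ≤ matrixGaussianDensity Abar σ A := by unfold matrixGaussianDensity; positivity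
    rw [Real.norm_of_nonneg (by positivity)]
    calc _ ≤ ((n.factorial : ℝ) ^ 2 * ∏ i, ∏ j, (1 + ‖A i j‖) ^ 2) * matrixGaussianDensity Abar σ A := by
          gcongr; exact det_bound A
      _ = _ := by simp only [dens_eq, Finset.prod_mul_distrib]; ring

lemma row_integral {n : ℕ} (Abar : Matrix (Fin (n + 1)) (Fin (n + 1)) ℂ) (σ : ℝ) (hσ : 0 < σ)
    (i : Fin (n + 1)) :
    Integrable (fun A : Fin (n + 1) → Fin (n + 1) → ℂ =>
      (∑ j, ‖(Matrix.of A).adjugate j i‖ ^ 2) * matrixGaussianDensity Abar σ A) ∧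
    (2 * σ ^ 2) * ∫ A : Fin (n + 1) → Fin (n + 1) → ℂ,
      (∑ j, ‖(Matrix.of A).adjugate j i‖ ^ 2) * matrixGaussianDensity Abar σ A ≤
    ∫ A : Fin (n + 1) → Fin (n + 1) → ℂ,
      ‖(Matrix.of A).det‖ ^ 2 * matrixGaussianDensity Abar σ A := by
  have h : 0 < 2 * σ ^ 2 := by positivity
  have hr : ∀ A, 0 ≤ matrixGaussianDensity Abar σ A := fun A => by
    unfold matrixGaussianDensity; positivity
  have key := main_row h (fun i j => Abar i j) i
  simp_rw [← dens_l Abar σ hσ] at key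
  have e1 : ∀ A : Fin (n + 1) → Fin (n + 1) → ℂ,
    ENNReal.ofReal (∑ j, ‖(Matrix.of A).adjugate j i‖ ^ 2) *
      ENNReal.ofReal (matrixGaussianDensity Abar σ A) =
    ENNReal.ofReal ((∑ j, ‖(Matrix.of A).adjugate j i‖ ^ 2) * matrixGaussianDensity Abar σ A) :=
    fun A => by rw [ENNReal.ofReal_mul (by positivity)]
  have e2 : ∀ A : Fin (n + 1) → Fin (n + 1) → ℂ,
    ENNReal.ofReal (‖(Matrix.of A).det‖ ^ 2) *
      ENNReal.ofReal (matrixGaussianDensity Abar σ A) =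
    ENNReal.ofReal (‖(Matrix.of A).det‖ ^ 2 * matrixGaussianDensity Abar σ A) :=
    fun A => by rw [ENNReal.ofReal_mul (by positivity)]
  simp_rw [e1, e2] at key
  rw [← ofReal_integral_eq_lintegral_ofReal (det_integrable Abar σ hσ)
    (Filter.Eventually.of_forall fun A => mul_nonneg (by positivity) (hr A))] at key
  have n1 : 0 ≤ᵐ[volume] (fun A : Fin (n + 1) → Fin (n + 1) → ℂ =>
      (∑ j, ‖(Matrix.of A).adjugate j i‖ ^ 2) * matrixGaussianDensity Abar σ A) :=
    Filter.Eventually.of_forall fun A => mul_nonneg (by positivity) (hr A)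
  have hint : Integrable (fun A : Fin (n + 1) → Fin (n + 1) → ℂ =>
      (∑ j, ‖(Matrix.of A).adjugate j i‖ ^ 2) * matrixGaussianDensity Abar σ A) := by
    refine ⟨?_, ?_⟩
    · have := gauss_cont Abar σ
      have := fun j => adj_cont (n := n + 1) j i
      exact Continuous.aestronglyMeasurable (by fun_prop)
    · rw [hasFiniteIntegral_iff_ofReal n1]
      by_contra hc
      rw [not_lt, top_le_iff] at hc
      rw [hc, ENNReal.mul_top (by simpa using hσ.ne')] at key
      simp at key
  refine ⟨hint, ?_⟩
  rw [← ofReal_integral_eq_lintegral_ofReal hint n1, ← ENNReal.ofReal_mul h.le] at key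
  exact (ENNReal.ofReal_le_ofReal_iff (integral_nonneg fun A =>
    mul_nonneg (by positivity) (hr A))).1 key

/-- Smoothed analysis of the matrix condition number, expectation bound
(Proposition `pro:fiberE`): `𝔼_{A ∼ ρ̃} ‖A⁻¹‖² ≤ e(n+1)/(2σ²)`, stated as an inequality
of integrals against the density `|det A|² ρ(A)`. -/
theorem expectation_inv_opNorm_sq_le
    (n : ℕ) (hn : 1 ≤ n) (Abar : Matrix (Fin n) (Fin n) ℂ) (σ : ℝ) (hσ : 0 < σ) :
    ∫ A : Fin n → Fin n → ℂ,
        matrixOpNorm (Matrix.of A)⁻¹ ^ 2 * (‖(Matrix.of A).det‖ ^ 2 *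
          matrixGaussianDensity Abar σ A)
      ≤ (Real.exp 1 * (n + 1) / (2 * σ ^ 2)) *
        ∫ A : Fin n → Fin n → ℂ, ‖(Matrix.of A).det‖ ^ 2 * matrixGaussianDensity Abar σ A := by
  obtain ⟨m, rfl⟩ : ∃ m, n = m + 1 := ⟨n - 1, by omega⟩
  have h : 0 < 2 * σ ^ 2 := by positivity
  have hr : ∀ A, 0 ≤ matrixGaussianDensity Abar σ A := fun A => by
    unfold matrixGaussianDensity; positivity
  set D := ∫ A : Fin (m + 1) → Fin (m + 1) → ℂ,
    ‖(Matrix.of A).det‖ ^ 2 * matrixGaussianDensity Abar σ A with hD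
  have hD0 : 0 ≤ D := integral_nonneg fun A => mul_nonneg (by positivity) (hr A)
  have hi := fun i => (row_integral Abar σ hσ i).1
  calc _ ≤ ∫ A : Fin (m + 1) → Fin (m + 1) → ℂ, ∑ i,
        (∑ j, ‖(Matrix.of A).adjugate j i‖ ^ 2) * matrixGaussianDensity Abar σ A := by
        refine integral_mono_of_nonneg (Filter.Eventually.of_forall fun A => ?_)
          (integrable_finsetSum _ fun i _ => hi i) (Filter.Eventually.of_forall fun A => ?_)
        · exact mul_nonneg (by positivity) (mul_nonneg (by positivity) (hr A))
        · simp only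
          rw [← mul_assoc, ← Finset.sum_mul]
          exact mul_le_mul_of_nonneg_right (inv_adj _) (hr A)
    _ = ∑ i, ∫ A : Fin (m + 1) → Fin (m + 1) → ℂ,
        (∑ j, ‖(Matrix.of A).adjugate j i‖ ^ 2) * matrixGaussianDensity Abar σ A :=
        integral_finsetSum _ fun i _ => hi i
    _ ≤ ∑ i : Fin (m + 1), D / (2 * σ ^ 2) := by
        refine Finset.sum_le_sum fun i _ => ?_
        rw [le_div_iff₀' h]
        exact (row_integral Abar σ hσ i).2
    _ = ((m + 1 : ℕ) : ℝ) / (2 * σ ^ 2) * D := by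
        rw [Finset.sum_const, Finset.card_univ, Fintype.card_fin, nsmul_eq_mul]; ring
    _ ≤ _ := by
        gcongr
        have := Real.add_one_le_exp 1
        have h2 : (0 : ℝ) ≤ ((m + 1 : ℕ) : ℝ) := by positivity
        nlinarith
end

section
/- Let n ≥ 1, let Ā ∈ ℂ^{n×n}, and let σ > 0. For any t > 0, the probability under the density ρ̃ of the event {A is invertible and ‖A⁻¹‖ ≥ t} is at most e²(n+1)²/(16σ⁴t⁴); equivalently, ∫_{A invertible, ‖A⁻¹‖ ≥ t} |det A|² ρ(A) dA ≤ (e²(n+1)²/(16σ⁴t⁴)) · ∫_{ℂ^{n×n}} |det A|² ρ(A) dA, where ‖A⁻¹‖ denotes the operator (spectral) norm. -/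
open MeasureTheory Matrix

/-- radial integration on `ℂ`. -/
lemma aux_radial (f : ℝ → ℝ) (hf : ∀ r, 0 ≤ f r) (c : ℝ) (hc : 0 < c)
    (h : ∫ r in Set.Ioi (0:ℝ), f r = c) :
    ∫⁻ z : ℂ, ENNReal.ofReal (f (‖z‖ ^ 2)) = ENNReal.ofReal (Real.pi * c) := by
  have h1 : ∫ z : ℂ, f (‖z‖ ^ 2) = Real.pi * c := by
    have := integral_fun_norm_addHaar (volume : Measure ℂ) (fun r => f (r ^ 2))
    rw [this]
    have h2 := integral_comp_rpow_Ioi f (two_ne_zero : (2:ℝ) ≠ 0)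
    have hv : (volume : Measure ℂ).real (Metric.ball 0 1) = Real.pi := by
      simp [Measure.real, Complex.volume_ball]
    rw [hv, Complex.finrank_real_complex]
    have h3 : ∫ x in Set.Ioi (0:ℝ), (|(2:ℝ)| * x ^ ((2:ℝ) - 1)) • f (x ^ (2:ℝ))
        = 2 * ∫ y in Set.Ioi (0:ℝ), y ^ (2 - 1) • f (y ^ 2) := by
      rw [← integral_const_mul]
      refine setIntegral_congr_fun measurableSet_Ioi (fun x hx => ?_)
      norm_num [mul_assoc]
    rw [h3, h] at h2
    rw [← h2]
    simp
    ring
  have hi : Integrable (fun z : ℂ => f (‖z‖ ^ 2)) := by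
    by_contra hcon
    rw [integral_undef hcon] at h1
    have := mul_pos Real.pi_pos hc
    linarith
  rw [← h1, ofReal_integral_eq_lintegral_ofReal hi (Filter.Eventually.of_forall fun z => hf _)]

lemma aux_disc (a : ℝ) (ha : 0 < a) :
    ∫⁻ z : ℂ, ENNReal.ofReal (if ‖z‖ ^ 2 ≤ a then ‖z‖ ^ 2 else 0)
      = ENNReal.ofReal (Real.pi * (a ^ 2 / 2)) := by
  have := aux_radial (fun r => if 0 ≤ r ∧ r ≤ a then r else 0)
    (fun r => by split_ifs with h; exacts [h.1, le_rfl]) (a ^ 2 / 2) (by positivity) ?_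
  · rw [← this]; simp
  · have : ∫ r in Set.Ioi (0:ℝ), (if 0 ≤ r ∧ r ≤ a then r else 0)
        = ∫ r in Set.Ioi (0:ℝ), (Set.Ioc 0 a).indicator (fun r => r) r := by
      refine setIntegral_congr_fun measurableSet_Ioi (fun x hx => ?_)
      have hx' : (0:ℝ) < x := hx
      simp [Set.indicator, hx', hx'.le]
    rw [this, setIntegral_indicator measurableSet_Ioc,
      Set.inter_eq_right.2 (fun x hx => hx.1), ← intervalIntegral.integral_of_le ha.le]
    simp

lemma aux_gauss_tail :
    ∫⁻ z : ℂ, ENNReal.ofReal (if 2 ≤ ‖z‖ ^ 2 then Real.exp (-‖z‖ ^ 2) else 0)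
      = ENNReal.ofReal (Real.pi * Real.exp (-2)) := by
  have := aux_radial (fun r => if 2 ≤ r then Real.exp (-r) else 0)
    (fun r => by split_ifs with h <;> positivity) (Real.exp (-2)) (by positivity) ?_
  · rw [← this]
  · have : ∫ r in Set.Ioi (0:ℝ), (if 2 ≤ r then Real.exp (-r) else 0)
        = ∫ r in Set.Ioi (0:ℝ), (Set.Ici 2).indicator (fun r => Real.exp (-r)) r := by
      refine setIntegral_congr_fun measurableSet_Ioi (fun x hx => ?_)
      simp [Set.indicator]
    rw [this, setIntegral_indicator measurableSet_Ici,
      show Set.Ioi (0:ℝ) ∩ Set.Ici 2 = Set.Ici 2 from Set.inter_eq_right.2 (Set.Ici_subset_Ioi.2 two_pos), integral_Ici_eq_integral_Ioi, integral_exp_neg_Ioi]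

lemma aux_gauss_zero :
    ∫⁻ z : ℂ, ENNReal.ofReal (Real.exp (-‖z‖ ^ 2)) = ENNReal.ofReal (Real.pi) := by
  have := aux_radial (fun r => Real.exp (-r)) (fun r => by positivity) 1 one_pos
    (by simpa using integral_exp_neg_Ioi 0)
  rw [mul_one] at this
  rw [← this]

lemma aux_gauss_two (b : ℝ) (hb : 0 < b) :
    ∫⁻ z : ℂ, ENNReal.ofReal (‖z‖ ^ 2 * Real.exp (-b * ‖z‖ ^ 2))
      = ENNReal.ofReal (Real.pi * (1 / b ^ 2)) := by
  have := aux_radial (fun r => |r| * Real.exp (-b * r)) (fun r => by positivity) (1 / b ^ 2)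
    (by positivity) ?_
  · rw [← this]; simp
  · have h := Real.integral_rpow_mul_exp_neg_mul_Ioi (a := 2) (r := b) two_pos hb
    norm_num at h
    rw [one_div, ← h]
    refine setIntegral_congr_fun measurableSet_Ioi (fun x hx => ?_)
    have hx' : (0:ℝ) < x := hx
    norm_num [abs_of_pos hx']

lemma aux_gauss_four :
    ∫⁻ z : ℂ, ENNReal.ofReal (‖z‖ ^ 4 * Real.exp (-‖z‖ ^ 2))
      = ENNReal.ofReal (Real.pi * 2) := by
  have := aux_radial (fun r => r ^ 2 * Real.exp (-r)) (fun r => by positivity) 2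
    (by positivity) ?_
  · rw [← this]; simp [← pow_mul]
  · have h := Real.integral_rpow_mul_exp_neg_mul_Ioi (a := 3) (r := 1) three_pos one_pos
    have h3 : Real.Gamma 3 = 2 := by
      have := Real.Gamma_nat_eq_factorial 2
      rw [show (3:ℝ) = ((2:ℕ):ℝ) + 1 by norm_num, this]; simp [Nat.factorial]
    norm_num [h3] at h
    rw [← h]

/-- second moment lower bound -/
lemma aux_second (b : ℝ) (hb : 0 < b) (μ : ℂ) :
    ENNReal.ofReal (Real.pi * (1 / b ^ 2)) ≤
      ∫⁻ z : ℂ, ENNReal.ofReal (‖z‖ ^ 2) * ENNReal.ofReal (Real.exp (-b * ‖z - μ‖ ^ 2)) := by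
  set I := ∫⁻ z : ℂ, ENNReal.ofReal (‖z‖ ^ 2) * ENNReal.ofReal (Real.exp (-b * ‖z - μ‖ ^ 2))
    with hI
  have h1 : I = ∫⁻ z : ℂ, ENNReal.ofReal (‖z + μ‖ ^ 2) * ENNReal.ofReal (Real.exp (-b * ‖z‖ ^ 2)) := by
    rw [hI, ← lintegral_add_right_eq_self _ μ]
    simp
  have h2 : I = ∫⁻ z : ℂ, ENNReal.ofReal (‖-z + μ‖ ^ 2) * ENNReal.ofReal (Real.exp (-b * ‖z‖ ^ 2)) := by
    rw [h1]
    conv_lhs => rw [← lintegral_neg_eq_self]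
    simp
  have h3 : 2 * ENNReal.ofReal (Real.pi * (1 / b ^ 2)) ≤ 2 * I := by
    rw [two_mul I]
    nth_rw 1 [h1]
    rw [h2, ← lintegral_add_left (by fun_prop), ← aux_gauss_two b hb,
      ← lintegral_const_mul _ (by fun_prop)]
    refine lintegral_mono (fun z => ?_)
    rw [← add_mul, ← ENNReal.ofReal_add (by positivity) (by positivity),
      ← ENNReal.ofReal_mul (by positivity), show (2:ENNReal) = ENNReal.ofReal 2 by simp,
      ← ENNReal.ofReal_mul (by positivity)]
    refine ENNReal.ofReal_le_ofReal ?_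
    rw [← mul_assoc]
    refine mul_le_mul_of_nonneg_right ?_ (by positivity)
    have := parallelogram_law_with_norm ℝ μ z
    have e1 : ‖-z + μ‖ = ‖μ - z‖ := by rw [neg_add_eq_sub]
    have e2 : ‖z + μ‖ = ‖μ + z‖ := by rw [add_comm]
    rw [e1, e2]
    nlinarith [sq_nonneg ‖μ‖]
  exact (ENNReal.mul_le_mul_iff_right (by simp) (by simp)).1 h3

lemma aux_one_dim (b s w : ℝ) (hb : 0 < b) (hs : 0 < s) (hw : 0 ≤ w) (μ : ℂ) :
    ∫⁻ z : ℂ, (if s * ‖z‖ ^ 2 ≤ w then ENNReal.ofReal (‖z‖ ^ 2) else 0) *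
        ENNReal.ofReal (Real.exp (-b * ‖z - μ‖ ^ 2))
      ≤ ENNReal.ofReal (b ^ 2 * w ^ 2 / (2 * s ^ 2)) *
      ∫⁻ z : ℂ, ENNReal.ofReal (‖z‖ ^ 2) * ENNReal.ofReal (Real.exp (-b * ‖z - μ‖ ^ 2)) := by
  rcases hw.eq_or_lt with rfl | hw
  · refine le_trans (le_of_eq ?_) zero_le
    rw [lintegral_eq_zero_iff' ]
    · refine Filter.Eventually.of_forall fun z => ?_
      dsimp only
      split_ifs with h
      · have : ‖z‖ ^ 2 ≤ 0 := by
          by_contra hh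
          push Not at hh
          nlinarith [mul_pos hs hh]
        simp [ENNReal.ofReal_eq_zero.2 this]
      · simp
    · refine Measurable.aemeasurable ?_
      refine Measurable.mul (Measurable.ite ?_ (by fun_prop) (by fun_prop)) (by fun_prop)
      exact measurableSet_le (by fun_prop) (by fun_prop)
  · calc _ ≤ ∫⁻ z : ℂ, ENNReal.ofReal (if ‖z‖ ^ 2 ≤ w / s then ‖z‖ ^ 2 else 0) := by
          refine lintegral_mono fun z => ?_
          dsimp only
          have : s * ‖z‖ ^ 2 ≤ w ↔ ‖z‖ ^ 2 ≤ w / s := by rw [le_div_iff₀ hs, mul_comm]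
          simp only [this]
          split_ifs
          · refine mul_le_of_le_one_right zero_le ?_
            rw [← ENNReal.ofReal_one]
            refine ENNReal.ofReal_le_ofReal (Real.exp_le_one_iff.2 ?_)
            have : 0 ≤ b * ‖z - μ‖ ^ 2 := by positivity
            linarith
          · simp
      _ = ENNReal.ofReal (b ^ 2 * w ^ 2 / (2 * s ^ 2)) * ENNReal.ofReal (Real.pi * (1 / b ^ 2)) := by
          rw [aux_disc _ (by positivity), ← ENNReal.ofReal_mul (by positivity)]
          congr 1
          field_simp
      _ ≤ _ := by gcongr; exact aux_second b hb μ

/-- squared Euclidean norm of a complex vector -/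
noncomputable def auxNsq {n : ℕ} (x : Fin n → ℂ) : ℝ := ∑ i, ‖x i‖ ^ 2

lemma auxNsq_nonneg {n : ℕ} (x : Fin n → ℂ) : 0 ≤ auxNsq x :=
  Finset.sum_nonneg fun i _ => by positivity

lemma auxNsq_cont {n : ℕ} : Continuous (auxNsq : (Fin n → ℂ) → ℝ) := by
  unfold auxNsq; fun_prop

@[fun_prop]
lemma auxNsq_meas {n : ℕ} : Measurable (auxNsq : (Fin n → ℂ) → ℝ) := auxNsq_cont.measurable

lemma auxNsq_smul {n : ℕ} (c : ℂ) (x : Fin n → ℂ) : auxNsq (c • x) = ‖c‖ ^ 2 * auxNsq x := by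
  simp [auxNsq, Finset.mul_sum, mul_pow]

lemma auxNsq_eq_dot {n : ℕ} (x : Fin n → ℂ) : ((auxNsq x : ℝ) : ℂ) = star x ⬝ᵥ x := by
  simp only [auxNsq, dotProduct, Complex.ofReal_sum, Pi.star_apply]
  refine Finset.sum_congr rfl fun i _ => ?_
  push_cast
  rw [← Complex.conj_mul']
  rfl

lemma auxNsq_eq_zero {n : ℕ} {x : Fin n → ℂ} (h : auxNsq x = 0) : x = 0 := by
  ext i
  have := (Finset.sum_eq_zero_iff_of_nonneg (fun i _ => by positivity)).1 h i (Finset.mem_univ i)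
  simpa using this

lemma auxNsq_mulVec {n : ℕ} (U : Matrix (Fin n) (Fin n) ℂ) (hU : Uᴴ * U = 1) (x : Fin n → ℂ) :
    auxNsq (U *ᵥ x) = auxNsq x := by
  have : ((auxNsq (U *ᵥ x) : ℝ) : ℂ) = (auxNsq x : ℝ) := by
    rw [auxNsq_eq_dot, auxNsq_eq_dot, star_mulVec, ← dotProduct_mulVec, mulVec_mulVec, hU,
      one_mulVec]
  exact_mod_cast this

lemma aux_norm_le {n : ℕ} (x : Fin n → ℂ) : ‖x‖ ^ 2 ≤ auxNsq x := by
  have h : ‖x‖ ≤ √(auxNsq x) := by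
    refine (pi_norm_le_iff_of_nonneg (Real.sqrt_nonneg _)).2 fun i => ?_
    refine Real.le_sqrt_of_sq_le ?_
    exact Finset.single_le_sum (f := fun i => ‖x i‖ ^ 2) (fun i _ => by positivity)
      (Finset.mem_univ i)
  calc ‖x‖ ^ 2 ≤ √(auxNsq x) ^ 2 := by gcongr
    _ = auxNsq x := Real.sq_sqrt (auxNsq_nonneg x)

lemma aux_norm_le_mat {n : ℕ} (x : Fin n → Fin n → ℂ) : ‖x‖ ^ 2 ≤ ∑ i, auxNsq (x i) := by
  have hn : 0 ≤ ∑ i, auxNsq (x i) := Finset.sum_nonneg fun i _ => auxNsq_nonneg _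
  have h : ‖x‖ ≤ √(∑ i, auxNsq (x i)) := by
    refine (pi_norm_le_iff_of_nonneg (Real.sqrt_nonneg _)).2 fun i => ?_
    refine Real.le_sqrt_of_sq_le ((aux_norm_le _).trans ?_)
    exact Finset.single_le_sum (f := fun i => auxNsq (x i)) (fun i _ => auxNsq_nonneg _)
      (Finset.mem_univ i)
  calc ‖x‖ ^ 2 ≤ √(∑ i, auxNsq (x i)) ^ 2 := by gcongr
    _ = _ := Real.sq_sqrt hn

/-- a linear map preserving a definite quadratic form preserves Lebesgue measure -/
lemma aux_preserving {E : Type*} [NormedAddCommGroup E] [NormedSpace ℝ E] [MeasurableSpace E]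
    [BorelSpace E] [FiniteDimensional ℝ E] (μ : Measure E) [μ.IsAddHaarMeasure]
    (q : E → ℝ) (hq : Continuous q) (hq0 : q 0 = 0) (hqn : ∀ x, ‖x‖ ^ 2 ≤ q x)
    (L : E →ₗ[ℝ] E) (hL : ∀ x, q (L x) = q x) : MeasurePreserving L μ μ := by
  have hinj : Function.Injective L := by
    rw [injective_iff_map_eq_zero]
    intro x hx
    have h1 := hqn x
    rw [← hL x, hx, hq0] at h1
    have : ‖x‖ ^ 2 = 0 := le_antisymm h1 (by positivity)
    simpa using this
  have hdet : LinearMap.det L ≠ 0 := by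
    have := LinearMap.ker_eq_bot.2 hinj
    intro h0
    have := LinearMap.bot_lt_ker_of_det_eq_zero h0
    simp_all
  set B : Set E := {x | q x < 1}
  have hB : L ⁻¹' B = B := by ext x; simp [B, hL]
  have hBo : IsOpen B := isOpen_lt hq continuous_const
  have hBne : μ B ≠ 0 := (hBo.measure_pos μ ⟨0, by simp [B, hq0]⟩).ne'
  have hBfin : μ B ≠ ⊤ := by
    refine ((measure_mono ?_).trans_lt (measure_ball_lt_top (x := (0:E)) (r := 1) (μ := μ))).ne
    intro x hx
    have h1 : q x < 1 := hx
    have h2 := hqn x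
    rw [mem_ball_zero_iff]
    nlinarith [norm_nonneg x]
  have h := Measure.addHaar_preimage_linearMap μ hdet B
  rw [hB] at h
  have h1 : ENNReal.ofReal |(LinearMap.det L)⁻¹| = 1 := by
    have h2 : 1 * μ B = ENNReal.ofReal |(LinearMap.det L)⁻¹| * μ B := by rw [one_mul]; exact h
    exact ((ENNReal.mul_left_inj hBne hBfin).1 h2).symm
  refine ⟨(LinearMap.continuous_of_finiteDimensional L).measurable, ?_⟩
  rw [Measure.map_linearMap_addHaar_eq_smul_addHaar μ hdet, h1, one_smul]

lemma aux_unitary {m : ℕ} (u : Fin (m + 1) → ℂ) :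
    ∃ U : Matrix (Fin (m + 1)) (Fin (m + 1)) ℂ, Uᴴ * U = 1 ∧ U * Uᴴ = 1 ∧
      U *ᵥ u = Pi.single 0 ((√(auxNsq u) : ℝ) : ℂ) := by
  by_cases hu : u = 0
  · refine ⟨1, by simp, by simp, ?_⟩
    simp [hu, auxNsq]
  set x : EuclideanSpace ℂ (Fin (m + 1)) := WithLp.toLp 2 u with hx
  have hxn : ‖x‖ = √(auxNsq u) := by
    rw [EuclideanSpace.norm_eq]; rfl
  have hx0 : ‖x‖ ≠ 0 := by
    rw [norm_ne_zero_iff]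
    intro h
    exact hu (by simpa [hx] using h)
  set v : Fin (m + 1) → EuclideanSpace ℂ (Fin (m + 1)) := fun _ => ((‖x‖ : ℂ)⁻¹) • x
  have hon : Orthonormal ℂ (({0} : Set (Fin (m+1))).domRestrict v) := by
    rw [orthonormal_iff_ite]
    rintro ⟨i, hi⟩ ⟨j, hj⟩
    have hi' : i = 0 := hi
    have hj' : j = 0 := hj
    subst hi' hj'
    simp only [Set.domRestrict, v, if_true]
    rw [inner_self_eq_norm_sq_to_K, norm_smul]
    simp [hx0]
  obtain ⟨b, hb⟩ := hon.exists_orthonormalBasis_extension_of_card_eq (by simp)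
  have hb0 : b 0 = ((‖x‖ : ℂ)⁻¹) • x := hb 0 rfl
  have hx' : x = (‖x‖ : ℂ) • b 0 := by
    rw [hb0, smul_smul, mul_inv_cancel₀ (by exact_mod_cast hx0), one_smul]
  have hUU : (Matrix.of fun i j => star (b i j) : Matrix (Fin (m + 1)) (Fin (m + 1)) ℂ) *
      (Matrix.of fun i j => star (b i j))ᴴ = 1 := by
    ext i k
    have h1 := orthonormal_iff_ite.1 b.orthonormal i k
    rw [PiLp.inner_apply] at h1
    rw [Matrix.mul_apply, Matrix.one_apply, ← h1]
    refine Finset.sum_congr rfl fun j _ => ?_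
    simp [mul_comm]
  refine ⟨Matrix.of fun i j => star (b i j), mul_eq_one_comm.1 hUU, hUU, ?_⟩
  ext i
  have h1 : (inner ℂ (b i) x : ℂ) = Pi.single (M := fun _ => ℂ) 0 ((√(auxNsq u) : ℝ) : ℂ) i := by
    conv_lhs => rw [hx', inner_smul_right, orthonormal_iff_ite.1 b.orthonormal i 0]
    rw [hxn, Pi.single_apply]
    split_ifs <;> simp
  rw [← h1, PiLp.inner_apply]
  simp [mulVec, dotProduct, hx, mul_comm]

lemma aux_mulVec_preserving {n : ℕ} (U : Matrix (Fin n) (Fin n) ℂ) (hU : Uᴴ * U = 1) :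
    MeasurePreserving (fun x : Fin n → ℂ => U *ᵥ x) volume volume :=
  aux_preserving volume auxNsq auxNsq_cont (by simp [auxNsq]) aux_norm_le
    ((Matrix.mulVecLin U).restrictScalars ℝ) (fun x => auxNsq_mulVec U hU x)

lemma aux_frob {n : ℕ} (U : Matrix (Fin n) (Fin n) ℂ) (hU : Uᴴ * U = 1)
    (A : Matrix (Fin n) (Fin n) ℂ) : ∑ i, auxNsq ((U * A) i) = ∑ i, auxNsq (A i) := by
  have h : ∀ B : Matrix (Fin n) (Fin n) ℂ, ∑ i, auxNsq (B i) = ∑ j, auxNsq (Bᵀ j) := by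
    intro B
    simp only [auxNsq]
    rw [Finset.sum_comm]
    rfl
  rw [h (U * A), h A]
  refine Finset.sum_congr rfl fun j _ => ?_
  rw [← auxNsq_mulVec U hU (Aᵀ j)]
  rfl

/-- left multiplication, as a real linear map on the function space -/
noncomputable def auxMulLeft {n : ℕ} (U : Matrix (Fin n) (Fin n) ℂ) :
    (Fin n → Fin n → ℂ) →ₗ[ℝ] (Fin n → Fin n → ℂ) where
  toFun A := U * (Matrix.of A)
  map_add' A B := mul_add U (Matrix.of A) (Matrix.of B)
  map_smul' c A := Matrix.mul_smul U c (Matrix.of A)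

lemma aux_mulLeft_preserving {n : ℕ} (U : Matrix (Fin n) (Fin n) ℂ) (hU : Uᴴ * U = 1) :
    MeasurePreserving (auxMulLeft U) volume volume := by
  have h1 : Continuous fun A : Fin n → Fin n → ℂ => ∑ i, auxNsq (A i) :=
    continuous_finsetSum _ fun i _ => auxNsq_cont.comp (continuous_apply i)
  have h2 : ∀ A : Fin n → Fin n → ℂ, ∑ i, auxNsq ((auxMulLeft U A) i) = ∑ i, auxNsq (A i) :=
    fun A => aux_frob U hU (Matrix.of A)
  have h3 : ∑ i, auxNsq ((0 : Fin n → Fin n → ℂ) i) = 0 := by simp [auxNsq]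
  have i1 : (volume : Measure (Fin n → ℂ)).IsAddHaarMeasure := inferInstance
  have i2 : SigmaFinite (volume : Measure (Fin n → ℂ)) := inferInstance
  have i3 : (volume : Measure (Fin n → Fin n → ℂ)).IsAddHaarMeasure :=
    Measure.pi.isAddHaarMeasure _
  exact aux_preserving (E := Fin n → Fin n → ℂ) volume (fun A => ∑ i, auxNsq (A i)) h1 h3
    aux_norm_le_mat (auxMulLeft U) h2

/-- Gaussian weight -/
noncomputable def auxG {n : ℕ} (b : ℝ) (c x : Fin n → ℂ) : ENNReal :=
  ENNReal.ofReal (Real.exp (-b * auxNsq (x - c)))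

@[fun_prop]
lemma auxG_meas {n : ℕ} (b : ℝ) (c : Fin n → ℂ) : Measurable (auxG b c) := by
  unfold auxG
  have : Measurable fun x : Fin n → ℂ => auxNsq (x - c) := 
    (auxNsq_cont.comp (continuous_id.sub continuous_const)).measurable
  fun_prop

/-- Gaussian integral of a function of a linear form -/
lemma aux_linear_form {m : ℕ} (b : ℝ) (c C : Fin (m + 1) → ℂ) :
    ∃ (μ : ℂ) (K : ENNReal), (c = 0 → μ = 0) ∧ ∀ f : ℂ → ENNReal, Measurable f →
      ∫⁻ a, f (a ⬝ᵥ C) * auxG b c a =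
        (∫⁻ z : ℂ, f ((√(auxNsq C) : ℝ) * z) * ENNReal.ofReal (Real.exp (-b * ‖z - μ‖ ^ 2))) * K := by
  obtain ⟨U, hU, hU', hUC⟩ := aux_unitary C
  have hT : (Uᵀ)ᴴ * Uᵀ = 1 := by
    have := congrArg Matrix.transpose hU'
    rw [Matrix.transpose_mul, Matrix.transpose_one] at this
    exact this
  have hT' : Uᵀ * (Uᵀ)ᴴ = 1 := mul_eq_one_comm.1 hT
  set d := (Uᵀ)ᴴ *ᵥ c with hd
  have hcd : c = Uᵀ *ᵥ d := by rw [hd, mulVec_mulVec, hT', one_mulVec]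
  refine ⟨d 0, ∫⁻ y : Fin m → ℂ, auxG b (fun i => d i.succ) y, ?_, ?_⟩
  · intro h; simp [hd, h]
  intro f hf
  have hdot : Measurable fun a : Fin (m + 1) → ℂ => a ⬝ᵥ C := by
    unfold dotProduct; fun_prop
  rw [← (aux_mulVec_preserving _ hT).lintegral_comp (by fun_prop)]
  have h1 : ∀ a : Fin (m + 1) → ℂ, (Uᵀ *ᵥ a) ⬝ᵥ C = (√(auxNsq C) : ℝ) * a 0 := by
    intro a
    rw [mulVec_transpose, ← dotProduct_mulVec, hUC, dotProduct_single, mul_comm]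
  have h2 : ∀ a : Fin (m + 1) → ℂ, auxG b c (Uᵀ *ᵥ a) =
      ENNReal.ofReal (Real.exp (-b * ‖a 0 - d 0‖ ^ 2)) *
        auxG b (fun i => d i.succ) (fun i => a i.succ) := by
    intro a
    unfold auxG
    rw [← ENNReal.ofReal_mul (by positivity), ← Real.exp_add]
    nth_rw 1 [hcd]
    rw [← mulVec_sub, auxNsq_mulVec _ hT]
    congr 2
    simp only [auxNsq, Fin.sum_univ_succ, Pi.sub_apply]
    ring
  simp only [h1, h2]
  rw [← lintegral_prod_mul (by fun_prop) (by fun_prop)]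
  have := (volume_preserving_piFinSuccAbove (fun _ : Fin (m + 1) => ℂ) 0).lintegral_comp
    (f := fun z : ℂ × (Fin m → ℂ) => f ((√(auxNsq C) : ℝ) * z.1) *
      ENNReal.ofReal (Real.exp (-b * ‖z.1 - d 0‖ ^ 2)) * auxG b (fun i => d i.succ) z.2)
    (by
      have := auxG_meas b (fun i => d i.succ)
      fun_prop)
  rw [← Measure.volume_eq_prod, ← this]
  refine lintegral_congr fun a => ?_
  rw [mul_assoc]
  rfl

lemma aux_row {m : ℕ} (b s w : ℝ) (hb : 0 < b) (hs : 0 < s) (hw : 0 ≤ w)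
    (c C : Fin (m + 1) → ℂ) :
    ∫⁻ a, (if s * ‖a ⬝ᵥ C‖ ^ 2 ≤ w * auxNsq C then ENNReal.ofReal (‖a ⬝ᵥ C‖ ^ 2) else 0) *
        auxG b c a
      ≤ ENNReal.ofReal (b ^ 2 * w ^ 2 / (2 * s ^ 2)) *
        ∫⁻ a, ENNReal.ofReal (‖a ⬝ᵥ C‖ ^ 2) * auxG b c a := by
  by_cases hC : C = 0
  · simp [hC]
  have hN : 0 < auxNsq C :=
    lt_of_le_of_ne (auxNsq_nonneg C) fun h => hC (auxNsq_eq_zero h.symm)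
  obtain ⟨μ, K, -, hK⟩ := aux_linear_form b c C
  have hm : Measurable fun z : ℂ =>
      (if s * ‖z‖ ^ 2 ≤ w * auxNsq C then ENNReal.ofReal (‖z‖ ^ 2) else 0) := by
    refine Measurable.ite (measurableSet_le (by fun_prop) (by fun_prop)) (by fun_prop) (by fun_prop)
  have hm' : Measurable fun z : ℂ =>
      (if s * ‖z‖ ^ 2 ≤ w then ENNReal.ofReal (‖z‖ ^ 2) else 0) := by
    refine Measurable.ite (measurableSet_le (by fun_prop) (by fun_prop)) (by fun_prop) (by fun_prop)
  have e1 := hK _ hm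
  have e2 := hK (fun z => ENNReal.ofReal (‖z‖ ^ 2)) (by fun_prop)
  rw [e1, e2]
  have hnorm : ∀ z : ℂ, ‖((√(auxNsq C) : ℝ) : ℂ) * z‖ ^ 2 = auxNsq C * ‖z‖ ^ 2 := by
    intro z
    rw [norm_mul, mul_pow, Complex.norm_real, Real.norm_of_nonneg (Real.sqrt_nonneg _),
      Real.sq_sqrt hN.le]
  have hiff : ∀ z : ℂ, s * (auxNsq C * ‖z‖ ^ 2) ≤ w * auxNsq C ↔ s * ‖z‖ ^ 2 ≤ w := by
    intro z
    rw [show s * (auxNsq C * ‖z‖ ^ 2) = (s * ‖z‖ ^ 2) * auxNsq C by ring]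
    exact mul_le_mul_iff_left₀ hN
  simp only [hnorm, hiff, ENNReal.ofReal_mul hN.le]
  have h1 : ∀ z : ℂ, (if s * ‖z‖ ^ 2 ≤ w then ENNReal.ofReal (auxNsq C) * ENNReal.ofReal (‖z‖ ^ 2)
        else 0) * ENNReal.ofReal (Real.exp (-b * ‖z - μ‖ ^ 2))
      = ENNReal.ofReal (auxNsq C) * ((if s * ‖z‖ ^ 2 ≤ w then ENNReal.ofReal (‖z‖ ^ 2) else 0) *
        ENNReal.ofReal (Real.exp (-b * ‖z - μ‖ ^ 2))) := by
    intro z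
    split_ifs
    · rw [mul_assoc]
    · simp
  simp only [h1, mul_assoc]
  rw [lintegral_const_mul _ (by fun_prop), lintegral_const_mul _ (by fun_prop)]
  calc _ ≤ ENNReal.ofReal (auxNsq C) * (ENNReal.ofReal (b ^ 2 * w ^ 2 / (2 * s ^ 2)) *
      ∫⁻ z : ℂ, ENNReal.ofReal (‖z‖ ^ 2) * ENNReal.ofReal (Real.exp (-b * ‖z - μ‖ ^ 2))) * K := by
        gcongr
        exact aux_one_dim b s w hb hs hw μ
    _ = _ := by ring

/-- Gaussian weight on matrices -/
noncomputable def auxGm {n : ℕ} (b : ℝ) (M A : Fin n → Fin n → ℂ) : ENNReal :=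
  ENNReal.ofReal (Real.exp (-b * ∑ i, auxNsq (A i - M i)))

@[fun_prop]
lemma auxGm_meas {n : ℕ} (b : ℝ) (M : Fin n → Fin n → ℂ) : Measurable (auxGm b M) := by
  unfold auxGm auxNsq
  fun_prop

lemma aux_det_cont {n : ℕ} :
    Continuous fun A : Fin n → Fin n → ℂ => (Matrix.of A).det :=
  Continuous.matrix_det (A := fun A : Fin n → Fin n → ℂ => Matrix.of A) continuous_id

lemma aux_adj_cont {n : ℕ} :
    Continuous fun A : Fin n → Fin n → ℂ => (Matrix.of A).adjugate :=
  Continuous.matrix_adjugate (A := fun A : Fin n → Fin n → ℂ => Matrix.of A) continuous_id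

lemma aux_mat_zero {m : ℕ} (b s w : ℝ) (hb : 0 < b) (hs : 0 < s) (hw : 0 ≤ w)
    (M : Fin (m + 1) → Fin (m + 1) → ℂ) :
    ∫⁻ A : Fin (m + 1) → Fin (m + 1) → ℂ,
        (if s * ‖(Matrix.of A).det‖ ^ 2 ≤ w * auxNsq (fun j => (Matrix.of A).adjugate j 0)
          then ENNReal.ofReal (‖(Matrix.of A).det‖ ^ 2) else 0) * auxGm b M A
      ≤ ENNReal.ofReal (b ^ 2 * w ^ 2 / (2 * s ^ 2)) *
        ∫⁻ A : Fin (m + 1) → Fin (m + 1) → ℂ,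
          ENNReal.ofReal (‖(Matrix.of A).det‖ ^ 2) * auxGm b M A := by
  have hdm : Measurable fun A : Fin (m + 1) → Fin (m + 1) → ℂ => (Matrix.of A).det :=
    aux_det_cont.measurable
  have ham : Measurable fun A : Fin (m + 1) → Fin (m + 1) → ℂ =>
      auxNsq (fun j => (Matrix.of A).adjugate j 0) := by
    refine (auxNsq_cont.comp (continuous_pi fun j => ?_)).measurable
    exact aux_adj_cont.matrix_elem j 0
  set F : (Fin (m + 1) → Fin (m + 1) → ℂ) → ENNReal := fun A =>
    (if s * ‖(Matrix.of A).det‖ ^ 2 ≤ w * auxNsq (fun j => (Matrix.of A).adjugate j 0)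
          then ENNReal.ofReal (‖(Matrix.of A).det‖ ^ 2) else 0) * auxGm b M A with hF
  set H : (Fin (m + 1) → Fin (m + 1) → ℂ) → ENNReal := fun A =>
    ENNReal.ofReal (‖(Matrix.of A).det‖ ^ 2) * auxGm b M A with hH
  have hFm : Measurable F := by
    refine Measurable.mul (Measurable.ite (measurableSet_le ?_ ?_) ?_ ?_) (by fun_prop) <;> fun_prop
  have hHm : Measurable H := by fun_prop
  -- cofactors
  let C : (Fin m → Fin (m + 1) → ℂ) → Fin (m + 1) → ℂ := fun R j =>
    (-1) ^ (j : ℕ) * (Matrix.of fun i k => R i (j.succAbove k)).det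
  have hdet : ∀ (a : Fin (m + 1) → ℂ) (R : Fin m → Fin (m + 1) → ℂ),
      (Matrix.of (Fin.cons a R : Fin (m + 1) → Fin (m + 1) → ℂ)).det = a ⬝ᵥ C R := by
    intro a R
    rw [Matrix.det_succ_row_zero]
    refine Finset.sum_congr rfl fun j _ => ?_
    have : (Matrix.of (Fin.cons a R : Fin (m + 1) → Fin (m + 1) → ℂ)).submatrix Fin.succ j.succAbove
      = Matrix.of fun i k => R i (j.succAbove k) := by ext i k; simp
    rw [this]
    simp [C]
    ring
  have hadj : ∀ (a : Fin (m + 1) → ℂ) (R : Fin m → Fin (m + 1) → ℂ),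
      (fun j => (Matrix.of (Fin.cons a R : Fin (m + 1) → Fin (m + 1) → ℂ)).adjugate j 0) = C R := by
    intro a R
    ext j
    rw [Matrix.adjugate_fin_succ_eq_det_submatrix]
    have : (Matrix.of (Fin.cons a R : Fin (m + 1) → Fin (m + 1) → ℂ)).submatrix
      (Fin.succAbove 0) j.succAbove = Matrix.of fun i k => R i (j.succAbove k) := by ext i k; simp
    rw [this]
    simp [C]
  have hG : ∀ (a : Fin (m + 1) → ℂ) (R : Fin m → Fin (m + 1) → ℂ),
      auxGm b M (Fin.cons a R : Fin (m + 1) → Fin (m + 1) → ℂ) =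
        auxG b (M 0) a * ENNReal.ofReal (Real.exp (-b * ∑ i, auxNsq (R i - M i.succ))) := by
    intro a R
    unfold auxGm auxG
    rw [← ENNReal.ofReal_mul (by positivity), ← Real.exp_add, Fin.sum_univ_succ]
    simp only [Fin.cons_zero, Fin.cons_succ]
    congr 2
    ring
  have hsplit : ∀ Φ : (Fin (m + 1) → Fin (m + 1) → ℂ) → ENNReal, Measurable Φ →
      ∫⁻ A, Φ A = ∫⁻ R : Fin m → Fin (m + 1) → ℂ, ∫⁻ a : Fin (m + 1) → ℂ, Φ (Fin.cons a R) := by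
    intro Φ hΦ
    have h1 := (volume_preserving_piFinSuccAbove (fun _ : Fin (m + 1) => Fin (m + 1) → ℂ) 0).symm
    rw [← h1.lintegral_comp hΦ, Measure.volume_eq_prod, lintegral_prod_symm]
    · refine lintegral_congr fun R => lintegral_congr fun a => ?_
      congr 1
      ext i
      refine Fin.cases ?_ (fun i => ?_) i <;> simp [MeasurableEquiv.piFinSuccAbove]
    · exact (hΦ.comp h1.measurable).aemeasurable
  rw [hsplit F hFm, hsplit H hHm, ← lintegral_const_mul' _ _ ENNReal.ofReal_ne_top]
  refine lintegral_mono fun R => ?_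
  simp only [hF, hH, hdet, hadj, hG]
  have hdot : Measurable fun a : Fin (m + 1) → ℂ => a ⬝ᵥ C R := by
    unfold dotProduct; fun_prop
  simp only [← mul_assoc]
  rw [lintegral_mul_const, lintegral_mul_const, ← mul_assoc]
  · gcongr
    exact aux_row b s w hb hs hw (M 0) (C R)
  · fun_prop
  · refine Measurable.mul (Measurable.ite (measurableSet_le ?_ ?_) ?_ ?_) (by fun_prop) <;> fun_prop

lemma aux_mat {m : ℕ} (b s : ℝ) (hb : 0 < b) (hs : 0 < s) (v : Fin (m + 1) → ℂ)
    (M : Fin (m + 1) → Fin (m + 1) → ℂ) :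
    ∫⁻ A : Fin (m + 1) → Fin (m + 1) → ℂ,
        (if s * ‖(Matrix.of A).det‖ ^ 2 ≤ auxNsq ((Matrix.of A).adjugate *ᵥ v)
          then ENNReal.ofReal (‖(Matrix.of A).det‖ ^ 2) else 0) * auxGm b M A
      ≤ ENNReal.ofReal (b ^ 2 * auxNsq v ^ 2 / (2 * s ^ 2)) *
        ∫⁻ A : Fin (m + 1) → Fin (m + 1) → ℂ,
          ENNReal.ofReal (‖(Matrix.of A).det‖ ^ 2) * auxGm b M A := by
  obtain ⟨U, hU, hU', hUv⟩ := aux_unitary v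
  have hdm : Measurable fun A : Fin (m + 1) → Fin (m + 1) → ℂ => (Matrix.of A).det :=
    aux_det_cont.measurable
  have ham : Measurable fun A : Fin (m + 1) → Fin (m + 1) → ℂ =>
      auxNsq ((Matrix.of A).adjugate *ᵥ v) :=
    (auxNsq_cont.comp (aux_adj_cont.matrix_mulVec continuous_const)).measurable
  have hV : (Uᴴ)ᴴ * Uᴴ = 1 := by rw [conjTranspose_conjTranspose]; exact hU'
  have hdU : ‖(Uᴴ).det‖ = 1 := by
    have h1 := congrArg Matrix.det hU
    rw [Matrix.det_mul, Matrix.det_one, Matrix.det_conjTranspose] at h1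
    have h2 := congrArg norm h1
    rw [norm_mul, norm_star, norm_one] at h2
    rw [Matrix.det_conjTranspose, norm_star]
    nlinarith [norm_nonneg U.det]
  have hadjU : (Uᴴ).adjugate = (Uᴴ).det • U := by
    calc (Uᴴ).adjugate = (Uᴴ).adjugate * (Uᴴ * U) := by rw [hU, mul_one]
      _ = _ := by rw [← mul_assoc, adjugate_mul, smul_mul_assoc, one_mul]
  have e0 : ∀ B : Fin (m + 1) → Fin (m + 1) → ℂ,
      Matrix.of (auxMulLeft Uᴴ B) = Uᴴ * Matrix.of B := fun B => rfl
  have e1 : ∀ B : Fin (m + 1) → Fin (m + 1) → ℂ,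
      ‖(Matrix.of (auxMulLeft Uᴴ B)).det‖ = ‖(Matrix.of B).det‖ := by
    intro B
    rw [e0, Matrix.det_mul, norm_mul, hdU, one_mul]
  have e2 : ∀ B : Fin (m + 1) → Fin (m + 1) → ℂ,
      auxNsq ((Matrix.of (auxMulLeft Uᴴ B)).adjugate *ᵥ v) =
        auxNsq v * auxNsq (fun j => (Matrix.of B).adjugate j 0) := by
    intro B
    rw [e0, adjugate_mul_distrib, ← mulVec_mulVec, hadjU, smul_mulVec, hUv, mulVec_smul,
      auxNsq_smul, hdU]
    have : (Matrix.of B).adjugate *ᵥ (Pi.single 0 ((√(auxNsq v) : ℝ) : ℂ)) =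
        ((√(auxNsq v) : ℝ) : ℂ) • (fun j => (Matrix.of B).adjugate j 0) := by
      ext j
      simp [mul_comm]
    rw [this, auxNsq_smul, Complex.norm_real, Real.norm_of_nonneg (Real.sqrt_nonneg _),
      Real.sq_sqrt (auxNsq_nonneg v)]
    ring
  have e3 : ∀ B : Fin (m + 1) → Fin (m + 1) → ℂ,
      auxGm b M (auxMulLeft Uᴴ B) = auxGm b (auxMulLeft U M) B := by
    intro B
    unfold auxGm
    have h1 : Uᴴ * (Matrix.of B - U * Matrix.of M) = Matrix.of (auxMulLeft Uᴴ B) - Matrix.of M := by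
      rw [mul_sub, ← mul_assoc, hU, one_mul, e0]
    have h2 := aux_frob Uᴴ hV (Matrix.of B - U * Matrix.of M)
    rw [h1] at h2
    have h3 : ∑ i, auxNsq ((auxMulLeft Uᴴ B) i - M i) = ∑ i, auxNsq (B i - (auxMulLeft U M) i) := h2
    rw [h3]
  have hmp := aux_mulLeft_preserving Uᴴ hV
  rw [← hmp.lintegral_comp (by
    refine Measurable.mul (Measurable.ite (measurableSet_le ?_ ?_) ?_ ?_) (by fun_prop) <;> fun_prop),
    ← hmp.lintegral_comp (f := fun A => ENNReal.ofReal (‖(Matrix.of A).det‖ ^ 2) * auxGm b M A)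
      (by fun_prop)]
  simp only [e1, e2, e3]
  exact aux_mat_zero b s (auxNsq v) hb hs (auxNsq_nonneg v) _

lemma aux_tail {m : ℕ} (u : Fin (m + 1) → ℂ) (hu : auxNsq u = 1) :
    ∫⁻ v, (if 2 ≤ ‖v ⬝ᵥ u‖ ^ 2 then 1 else 0) * auxG 1 0 v
      = ENNReal.ofReal (Real.exp (-2)) * ∫⁻ v : Fin (m + 1) → ℂ, auxG 1 0 v := by
  obtain ⟨μ, K, hμ, hK⟩ := aux_linear_form 1 0 u
  have hμ := hμ rfl
  subst hμ
  have e1 := hK (fun z => if 2 ≤ ‖z‖ ^ 2 then 1 else 0)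
    (Measurable.ite (measurableSet_le (by fun_prop) (by fun_prop)) (by fun_prop) (by fun_prop))
  have e2 := hK (fun z => 1) (by fun_prop)
  simp only [hu, Real.sqrt_one, Complex.ofReal_one, one_mul, sub_zero, neg_mul] at e1 e2
  rw [e1, e2, aux_gauss_zero]
  have : ∀ z : ℂ, (if 2 ≤ ‖z‖ ^ 2 then (1 : ENNReal) else 0) * ENNReal.ofReal (Real.exp (-‖z‖ ^ 2))
      = ENNReal.ofReal (if 2 ≤ ‖z‖ ^ 2 then Real.exp (-‖z‖ ^ 2) else 0) := by
    intro z; split_ifs <;> simp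
  simp only [this]
  rw [aux_gauss_tail, ENNReal.ofReal_mul (by positivity)]
  ring

lemma aux_fourth_coord {m : ℕ} (i : Fin (m + 1)) :
    ∫⁻ v, ENNReal.ofReal (‖v i‖ ^ 4) * auxG 1 0 v
      = 2 * ∫⁻ v : Fin (m + 1) → ℂ, auxG 1 0 v := by
  have hu : auxNsq (Pi.single i (1 : ℂ) : Fin (m + 1) → ℂ) = 1 := by
    simp [auxNsq, Pi.single_apply, apply_ite]
  obtain ⟨μ, K, hμ, hK⟩ := aux_linear_form 1 0 (Pi.single i (1 : ℂ) : Fin (m + 1) → ℂ)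
  have hμ := hμ rfl
  subst hμ
  have e1 := hK (fun z => ENNReal.ofReal (‖z‖ ^ 4)) (by fun_prop)
  have e2 := hK (fun z => 1) (by fun_prop)
  simp only [hu, Real.sqrt_one, Complex.ofReal_one, one_mul, sub_zero, neg_mul, dotProduct_single,
    mul_one] at e1 e2
  rw [e1, e2, aux_gauss_zero]
  simp only [← ENNReal.ofReal_mul (pow_nonneg (norm_nonneg _) 4)]
  rw [aux_gauss_four, ENNReal.ofReal_mul (by positivity)]
  simp
  ring

lemma aux_fourth {m : ℕ} :
    ∫⁻ v : Fin (m + 1) → ℂ, ENNReal.ofReal (auxNsq v ^ 2) * auxG 1 0 v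
      ≤ ENNReal.ofReal (2 * (m + 1 : ℝ) ^ 2) * ∫⁻ v : Fin (m + 1) → ℂ, auxG 1 0 v := by
  calc _ ≤ ∫⁻ v : Fin (m + 1) → ℂ, ENNReal.ofReal (m + 1 : ℝ) *
        ∑ i, (ENNReal.ofReal (‖v i‖ ^ 4) * auxG 1 0 v) := by
        refine lintegral_mono fun v => ?_
        dsimp only
        rw [← Finset.sum_mul, ← mul_assoc, ← ENNReal.ofReal_sum_of_nonneg (fun i _ => by positivity),
          ← ENNReal.ofReal_mul (by positivity)]
        gcongr
        have := sq_sum_le_card_mul_sum_sq (s := Finset.univ) (f := fun i => ‖v i‖ ^ 2)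
        simpa [auxNsq, ← pow_mul] using this
    _ = _ := by
        rw [lintegral_const_mul _ (by fun_prop), lintegral_finsetSum _ (fun i _ => by fun_prop)]
        simp only [aux_fourth_coord]
        rw [Finset.sum_const, Finset.card_univ, Fintype.card_fin, nsmul_eq_mul, ← mul_assoc,
          ← mul_assoc]
        congr 1
        rw [show (2 * (m + 1 : ℝ) ^ 2) = (m + 1) * ((m + 1 : ℕ) : ℝ) * 2 by push_cast; ring,
          ENNReal.ofReal_mul (by positivity), ENNReal.ofReal_mul (by positivity),
          ENNReal.ofReal_natCast]
        simp

lemma aux_int_one (b : ℝ) (hb : 0 < b) (c : ℂ) :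
    Integrable fun z : ℂ => (1 + ‖z‖) ^ 2 * Real.exp (-b * ‖z - c‖ ^ 2) := by
  have h0 : Integrable fun z : ℂ => Real.exp (-b * ‖z‖ ^ 2) := by
    have h := Complex.integral_rpow_mul_exp_neg_mul_rpow (p := 2) (q := 0) (b := b)
      one_le_two (by norm_num) hb
    by_contra hcon
    have h2 : ∫ z : ℂ, ‖z‖ ^ (0:ℝ) * Real.exp (-b * ‖z‖ ^ (2:ℝ)) = 0 := by
      simpa using integral_undef hcon
    rw [h2] at h
    have : 0 < 2 * Real.pi / 2 * b ^ (-((0:ℝ) + 2) / 2) * Real.Gamma ((0 + 2) / 2) := by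
      have := Real.Gamma_pos_of_pos (show (0:ℝ) < (0 + 2) / 2 by norm_num)
      have := Real.rpow_pos_of_pos hb (-((0:ℝ) + 2) / 2)
      positivity
    linarith
  have h2 : Integrable fun z : ℂ => ‖z‖ ^ 2 * Real.exp (-b * ‖z‖ ^ 2) := by
    have h := Complex.integral_rpow_mul_exp_neg_mul_rpow (p := 2) (q := 2) (b := b)
      one_le_two (by norm_num) hb
    by_contra hcon
    have h2 : ∫ z : ℂ, ‖z‖ ^ (2:ℝ) * Real.exp (-b * ‖z‖ ^ (2:ℝ)) = 0 := by
      simpa using integral_undef hcon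
    rw [h2] at h
    have : 0 < 2 * Real.pi / 2 * b ^ (-((2:ℝ) + 2) / 2) * Real.Gamma ((2 + 2) / 2) := by
      have := Real.Gamma_pos_of_pos (show (0:ℝ) < (2 + 2) / 2 by norm_num)
      have := Real.rpow_pos_of_pos hb (-((2:ℝ) + 2) / 2)
      positivity
    linarith
  have h3 : Integrable fun z : ℂ => (1 + ‖z + c‖) ^ 2 * Real.exp (-b * ‖z‖ ^ 2) := by
    refine Integrable.mono' (((h0.const_mul (2 * (1 + ‖c‖) ^ 2))).add (h2.const_mul 2)) ?_ ?_
    · exact Measurable.aestronglyMeasurable (by fun_prop)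
    · refine Filter.Eventually.of_forall fun z => ?_
      rw [Real.norm_of_nonneg (by positivity)]
      simp only [Pi.add_apply]
      rw [← mul_assoc, ← add_mul]
      refine mul_le_mul_of_nonneg_right ?_ (by positivity)
      have h4 := norm_add_le z c
      have h5 : (1 + ‖z + c‖) ^ 2 ≤ (1 + (‖z‖ + ‖c‖)) ^ 2 := by gcongr
      nlinarith [sq_nonneg (1 + ‖c‖ - ‖z‖)]
  have := h3.comp_sub_right c
  simpa using this

lemma aux_one_le_prod {ι : Type*} (S : Finset ι) (f : ι → ℝ) (h : ∀ i, 1 ≤ f i) :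
    1 ≤ ∏ i ∈ S, f i := by
  calc (1:ℝ) = ∏ i ∈ S, (1:ℝ) := by simp
    _ ≤ _ := Finset.prod_le_prod (fun i _ => zero_le_one) fun i _ => h i

lemma aux_det_bound {n : ℕ} (A : Matrix (Fin n) (Fin n) ℂ) :
    ‖A.det‖ ≤ (n.factorial : ℝ) * ∏ i, ∏ j, (1 + ‖A i j‖) := by
  rw [Matrix.det_apply]
  refine (norm_sum_le _ _).trans ?_
  have : ∀ τ ∈ (Finset.univ : Finset (Equiv.Perm (Fin n))),
      ‖Equiv.Perm.sign τ • ∏ i, A (τ i) i‖ ≤ ∏ i, ∏ j, (1 + ‖A i j‖) := by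
    intro τ _
    have h1 : ‖Equiv.Perm.sign τ • ∏ i, A (τ i) i‖ = ∏ i, ‖A (τ i) i‖ := by
      rcases Int.units_eq_one_or (Equiv.Perm.sign τ) with h | h <;> simp [h, norm_prod]
    rw [h1, Finset.prod_comm]
    refine Finset.prod_le_prod (fun i _ => norm_nonneg _) fun i _ => ?_
    calc ‖A (τ i) i‖ ≤ 1 + ‖A (τ i) i‖ := by linarith
      _ ≤ ∏ k, (1 + ‖A k i‖) := by
          rw [← Finset.mul_prod_erase _ _ (Finset.mem_univ (τ i))]
          exact le_mul_of_one_le_right (by positivity)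
            (aux_one_le_prod _ _ fun k => by linarith [norm_nonneg (A k i)])
  refine (Finset.sum_le_sum this).trans (le_of_eq ?_)
  simp [Fintype.card_perm]

lemma aux_integrable {n : ℕ} (b : ℝ) (hb : 0 < b) (M : Fin n → Fin n → ℂ) :
    Integrable fun A : Fin n → Fin n → ℂ =>
      ‖(Matrix.of A).det‖ ^ 2 * Real.exp (-b * ∑ i, ∑ j, ‖A i j - M i j‖ ^ 2) := by
  have h1 : ∀ i, Integrable fun x : Fin n → ℂ =>
      ∏ j, ((1 + ‖x j‖) ^ 2 * Real.exp (-b * ‖x j - M i j‖ ^ 2)) := fun i =>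
    Integrable.fintype_prod (f := fun j z => (1 + ‖z‖) ^ 2 * Real.exp (-b * ‖z - M i j‖ ^ 2))
      (fun j => aux_int_one b hb (M i j))
  have h2 : Integrable fun A : Fin n → Fin n → ℂ =>
      ∏ i, ∏ j, ((1 + ‖A i j‖) ^ 2 * Real.exp (-b * ‖A i j - M i j‖ ^ 2)) :=
    Integrable.fintype_prod (f := fun i (x : Fin n → ℂ) =>
      ∏ j, ((1 + ‖x j‖) ^ 2 * Real.exp (-b * ‖x j - M i j‖ ^ 2))) h1
  refine Integrable.mono' (h2.const_mul ((n.factorial : ℝ) ^ 2)) ?_ ?_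
  · have := (aux_det_cont (n := n)).measurable
    exact Measurable.aestronglyMeasurable (by fun_prop)
  · refine Filter.Eventually.of_forall fun A => ?_
    rw [Real.norm_of_nonneg (by positivity)]
    simp only [Finset.prod_mul_distrib, ← Real.exp_sum, Finset.prod_pow, Finset.mul_sum]
    rw [← mul_assoc, ← mul_pow]
    refine mul_le_mul_of_nonneg_right ?_ (by positivity)
    have := aux_det_bound (Matrix.of A)
    simp only [Matrix.of_apply] at this
    gcongr

lemma aux_Z_ne_top {n : ℕ} : ∫⁻ v : Fin n → ℂ, auxG 1 0 v ≠ ⊤ := by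
  have h1 : Integrable fun x : Fin n → ℂ =>
      ∏ j, ((1 + ‖x j‖) ^ 2 * Real.exp (-1 * ‖x j - 0‖ ^ 2)) :=
    Integrable.fintype_prod (f := fun _ z => (1 + ‖z‖) ^ 2 * Real.exp (-1 * ‖z - 0‖ ^ 2))
      (fun j => aux_int_one 1 one_pos 0)
  refine (lt_of_le_of_lt (lintegral_mono fun v => ?_) h1.lintegral_lt_top).ne
  unfold auxG
  refine ENNReal.ofReal_le_ofReal ?_
  simp only [Finset.prod_mul_distrib, ← Real.exp_sum, auxNsq, Finset.mul_sum, Pi.sub_apply,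
    Pi.zero_apply]
  refine le_mul_of_one_le_left (by positivity) ?_
  refine aux_one_le_prod _ _ fun i => ?_
  nlinarith [norm_nonneg (v i)]

lemma aux_Z_ne_zero {n : ℕ} : ∫⁻ v : Fin n → ℂ, auxG 1 0 v ≠ 0 := by
  intro h
  rw [lintegral_eq_zero_iff (by fun_prop)] at h
  have h2 : ∀ᵐ v : Fin n → ℂ, False := by
    filter_upwards [h] with v hv
    simp [auxG] at hv
    exact absurd hv (not_le.2 (Real.exp_pos _))
  have h3 : (volume : Measure (Fin n → ℂ)) = 0 := by simpa using h2
  exact NeZero.ne _ h3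

lemma aux_direction {m : ℕ} (N : Matrix (Fin (m + 1)) (Fin (m + 1)) ℂ) (t : ℝ) (ht : 0 < t)
    (hN : t ≤ matrixOpNorm N) :
    ∃ u : Fin (m + 1) → ℂ, auxNsq u = 1 ∧ ∀ v, t ^ 2 * ‖v ⬝ᵥ u‖ ^ 2 ≤ auxNsq (N *ᵥ v) := by
  set f := LinearMap.toContinuousLinearMap (Matrix.toEuclideanLin N) with hf
  set g := ContinuousLinearMap.adjoint f with hg
  have hgn : t ≤ ‖g‖ := by rw [hg, LinearIsometryEquiv.norm_map]; exact hN
  obtain ⟨x, hx, hxm⟩ := (isCompact_sphere (0 : EuclideanSpace ℂ (Fin (m + 1))) 1).exists_isMaxOn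
    (NormedSpace.sphere_nonempty.2 zero_le_one) (f := fun x => ‖g x‖)
    (by fun_prop)
  have hx1 : ‖x‖ = 1 := by simpa using hx
  have hgx : t ≤ ‖g x‖ := by
    refine hgn.trans (ContinuousLinearMap.opNorm_le_bound _ (norm_nonneg _) fun y => ?_)
    by_cases hy : y = 0
    · simp [hy]
    have hy' : ‖y‖ ≠ 0 := norm_ne_zero_iff.2 hy
    have h1 := hxm (a := ((‖y‖ : ℂ)⁻¹) • y) (by
      rw [mem_sphere_zero_iff_norm, norm_smul]; simp [hy'])
    have h2 : ‖g (((‖y‖ : ℂ)⁻¹) • y)‖ ≤ ‖g x‖ := h1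
    rw [map_smul, norm_smul] at h2
    simp only [norm_inv, Complex.norm_real, norm_norm] at h2
    rwa [inv_mul_le_iff₀ (by positivity), mul_comm] at h2
  set y := g x with hy
  have hy0 : 0 < ‖y‖ := lt_of_lt_of_le ht hgx
  have hnsq : ∀ z : EuclideanSpace ℂ (Fin (m + 1)), auxNsq (fun i => z i) = ‖z‖ ^ 2 := by
    intro z
    rw [EuclideanSpace.norm_sq_eq]; rfl
  refine ⟨((‖y‖ : ℂ)⁻¹) • (fun i => star (y i)), ?_, fun v => ?_⟩
  · rw [auxNsq_smul]
    have : auxNsq (fun i => star (y i)) = ‖y‖ ^ 2 := by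
      rw [← hnsq]; simp [auxNsq]
    rw [this]
    simp [hy0.ne']
  · have h1 : v ⬝ᵥ (fun i => star (y i)) = inner ℂ y (WithLp.toLp 2 v) := by
      rw [PiLp.inner_apply]
      simp [dotProduct]
    have h2 : auxNsq (N *ᵥ v) = ‖f (WithLp.toLp 2 v)‖ ^ 2 := by
      rw [← hnsq]
      rfl
    have h3 : ‖(inner ℂ y (WithLp.toLp 2 v) : ℂ)‖ ≤ ‖f (WithLp.toLp 2 v)‖ := by
      rw [hy, hg, ContinuousLinearMap.adjoint_inner_left]
      refine (norm_inner_le_norm _ _).trans ?_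
      rw [hx1, one_mul]
    rw [dotProduct_smul, h1, h2, smul_eq_mul, norm_mul, norm_inv, Complex.norm_real, norm_norm,
      ← mul_pow]
    refine pow_le_pow_left₀ (by positivity) ?_ 2
    calc t * (‖y‖⁻¹ * ‖(inner ℂ y (WithLp.toLp 2 v) : ℂ)‖)
        ≤ ‖y‖ * (‖y‖⁻¹ * ‖(inner ℂ y (WithLp.toLp 2 v) : ℂ)‖) := by gcongr
      _ = ‖(inner ℂ y (WithLp.toLp 2 v) : ℂ)‖ := by field_simp
      _ ≤ _ := h3

lemma aux_main {m : ℕ} (b t : ℝ) (hb : 0 < b) (ht : 0 < t)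
    (M : Fin (m + 1) → Fin (m + 1) → ℂ) :
    ∫⁻ A in {A : Fin (m + 1) → Fin (m + 1) → ℂ | IsUnit (Matrix.of A).det ∧
        t ≤ matrixOpNorm (Matrix.of A)⁻¹},
        ENNReal.ofReal (‖(Matrix.of A).det‖ ^ 2) * auxGm b M A
      ≤ ENNReal.ofReal (Real.exp 2 * (b ^ 2 * (m + 1) ^ 2 / (4 * t ^ 4))) *
        ∫⁻ A : Fin (m + 1) → Fin (m + 1) → ℂ,
          ENNReal.ofReal (‖(Matrix.of A).det‖ ^ 2) * auxGm b M A := by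
  set T := {A : Fin (m + 1) → Fin (m + 1) → ℂ | IsUnit (Matrix.of A).det ∧
        t ≤ matrixOpNorm (Matrix.of A)⁻¹}
  set Z := ∫⁻ v : Fin (m + 1) → ℂ, auxG 1 0 v with hZ
  have hZ0 : Z ≠ 0 := aux_Z_ne_zero
  have hZt : Z ≠ ⊤ := aux_Z_ne_top
  set I := ∫⁻ A : Fin (m + 1) → Fin (m + 1) → ℂ,
          ENNReal.ofReal (‖(Matrix.of A).det‖ ^ 2) * auxGm b M A
  let F : (Fin (m + 1) → Fin (m + 1) → ℂ) → (Fin (m + 1) → ℂ) → ENNReal := fun A v =>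
    ((if (2 * t ^ 2) * ‖(Matrix.of A).det‖ ^ 2 ≤ auxNsq ((Matrix.of A).adjugate *ᵥ v)
          then ENNReal.ofReal (‖(Matrix.of A).det‖ ^ 2) else 0) * auxGm b M A) * auxG 1 0 v
  have hdm : Measurable fun A : Fin (m + 1) → Fin (m + 1) → ℂ => (Matrix.of A).det :=
    aux_det_cont.measurable
  have ham : Measurable fun p : (Fin (m + 1) → Fin (m + 1) → ℂ) × (Fin (m + 1) → ℂ) =>
      auxNsq ((Matrix.of p.1).adjugate *ᵥ p.2) :=
    (auxNsq_cont.comp ((aux_adj_cont.comp continuous_fst).matrix_mulVec continuous_snd)).measurable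
  have hFm : Measurable (Function.uncurry F) := by
    have hG := auxG_meas 1 (0 : Fin (m + 1) → ℂ)
    have hGm := auxGm_meas b M
    have hdm' : Measurable fun p : (Fin (m + 1) → Fin (m + 1) → ℂ) × (Fin (m + 1) → ℂ) =>
      (Matrix.of p.1).det := hdm.comp measurable_fst
    refine Measurable.mul (Measurable.mul (Measurable.ite (measurableSet_le ?_ ham) ?_ ?_)
      (by fun_prop)) (by fun_prop) <;> fun_prop
  have step1 : ∀ A ∈ T, ENNReal.ofReal (‖(Matrix.of A).det‖ ^ 2) * auxGm b M A *
      (ENNReal.ofReal (Real.exp (-2)) * Z) ≤ ∫⁻ v, F A v := by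
    rintro A ⟨hA, hAt⟩
    obtain ⟨u, hu, huv⟩ := aux_direction _ t ht hAt
    rw [hZ, ← aux_tail u hu, ← lintegral_const_mul' _ _ (by
      exact ENNReal.mul_ne_top ENNReal.ofReal_ne_top ENNReal.ofReal_ne_top)]
    refine lintegral_mono fun v => ?_
    simp only [F]
    rw [← mul_assoc]
    refine mul_le_mul_left ?_ _
    split_ifs with h1 h2 h2
    · simp
    · exfalso
      apply h2
      have h3 := huv v
      have h4 : (Matrix.of A).adjugate = (Matrix.of A).det • (Matrix.of A)⁻¹ := by
        rw [Matrix.inv_def, smul_smul, Ring.mul_inverse_cancel _ hA, one_smul]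
      rw [h4, smul_mulVec, auxNsq_smul]
      have h5 : 2 * t ^ 2 ≤ auxNsq ((Matrix.of A)⁻¹ *ᵥ v) := by
        refine le_trans ?_ h3
        nlinarith [sq_nonneg t, mul_le_mul_of_nonneg_left h1 (sq_nonneg t)]
      nlinarith [mul_le_mul_of_nonneg_left h5 (sq_nonneg ‖(Matrix.of A).det‖)]
    · simp
    · simp
  have step2 : (∫⁻ A in T, ENNReal.ofReal (‖(Matrix.of A).det‖ ^ 2) * auxGm b M A) *
      (ENNReal.ofReal (Real.exp (-2)) * Z) ≤
      ENNReal.ofReal (b ^ 2 / (8 * t ^ 4)) * I * (ENNReal.ofReal (2 * (m + 1 : ℝ) ^ 2) * Z) := by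
    calc _ = ∫⁻ A in T, ENNReal.ofReal (‖(Matrix.of A).det‖ ^ 2) * auxGm b M A *
            (ENNReal.ofReal (Real.exp (-2)) * Z) := by
          rw [lintegral_mul_const' _ _ (ENNReal.mul_ne_top ENNReal.ofReal_ne_top hZt)]
      _ ≤ ∫⁻ A in T, ∫⁻ v, F A v := setLIntegral_mono (hFm.lintegral_prod_right') step1
      _ ≤ ∫⁻ A, ∫⁻ v, F A v := setLIntegral_le_lintegral _ _
      _ = ∫⁻ v, ∫⁻ A, F A v := lintegral_lintegral_swap hFm.aemeasurable
      _ ≤ ∫⁻ v, (ENNReal.ofReal (b ^ 2 / (8 * t ^ 4)) * I) *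
            (ENNReal.ofReal (auxNsq v ^ 2) * auxG 1 0 v) := by
          refine lintegral_mono fun v => ?_
          simp only [F]
          have hGt : auxG 1 0 v ≠ ⊤ := ENNReal.ofReal_ne_top
          rw [lintegral_mul_const' _ _ hGt, ← mul_assoc]
          refine mul_le_mul_left ?_ _
          refine (aux_mat b (2 * t ^ 2) hb (by positivity) v M).trans (le_of_eq ?_)
          rw [mul_right_comm, ← ENNReal.ofReal_mul (by positivity)]
          congr 2
          field_simp
          ring
      _ = (ENNReal.ofReal (b ^ 2 / (8 * t ^ 4)) * I) *
            ∫⁻ v : Fin (m + 1) → ℂ, (ENNReal.ofReal (auxNsq v ^ 2) * auxG 1 0 v) := by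
          rw [lintegral_const_mul _ (by fun_prop)]
      _ ≤ _ := by gcongr; exact aux_fourth
  have step3 : (∫⁻ A in T, ENNReal.ofReal (‖(Matrix.of A).det‖ ^ 2) * auxGm b M A) *
      (ENNReal.ofReal (Real.exp (-2)) * Z) ≤
      (ENNReal.ofReal (Real.exp 2 * (b ^ 2 * (m + 1) ^ 2 / (4 * t ^ 4))) * I) *
      (ENNReal.ofReal (Real.exp (-2)) * Z) := by
    refine step2.trans (le_of_eq ?_)
    have e : ENNReal.ofReal (b ^ 2 / (8 * t ^ 4)) * ENNReal.ofReal (2 * (m + 1 : ℝ) ^ 2) =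
        ENNReal.ofReal (Real.exp 2 * (b ^ 2 * (m + 1) ^ 2 / (4 * t ^ 4))) *
          ENNReal.ofReal (Real.exp (-2)) := by
      rw [← ENNReal.ofReal_mul (by positivity), ← ENNReal.ofReal_mul (by positivity)]
      congr 1
      rw [mul_right_comm, ← Real.exp_add]
      norm_num
      field_simp
      norm_num
    calc _ = (ENNReal.ofReal (b ^ 2 / (8 * t ^ 4)) * ENNReal.ofReal (2 * (m + 1 : ℝ) ^ 2)) * I * Z := by
          ring
      _ = _ := by rw [e]; ring
  refine (ENNReal.mul_le_mul_iff_left ?_ ?_).1 step3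
  · refine mul_ne_zero ?_ hZ0
    simp [Real.exp_pos]
  · exact ENNReal.mul_ne_top ENNReal.ofReal_ne_top hZt

/-- Tail bound for the operator norm of the inverse (Lemma `le:condprobound`): for any `t > 0`,
the probability under the density `ρ̃ ∝ |det A|² ρ(A)` of the event
`{A invertible and ‖A⁻¹‖ ≥ t}` is at most `e²(n+1)²/(16σ⁴t⁴)`, stated as an inequality
of integrals. -/
theorem prob_inv_opNorm_ge_le
    (n : ℕ) (hn : 1 ≤ n) (Abar : Matrix (Fin n) (Fin n) ℂ) (σ : ℝ) (hσ : 0 < σ)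
    (t : ℝ) (ht : 0 < t) :
    ∫ A in {A : Fin n → Fin n → ℂ | IsUnit (Matrix.of A).det ∧
        t ≤ matrixOpNorm (Matrix.of A)⁻¹},
        ‖(Matrix.of A).det‖ ^ 2 * matrixGaussianDensity Abar σ A
      ≤ (Real.exp 1 ^ 2 * (n + 1) ^ 2 / (16 * σ ^ 4 * t ^ 4)) *
        ∫ A : Fin n → Fin n → ℂ, ‖(Matrix.of A).det‖ ^ 2 * matrixGaussianDensity Abar σ A := by
  obtain ⟨m, rfl⟩ : ∃ m, n = m + 1 := ⟨n - 1, by omega⟩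
  set b : ℝ := 1 / (2 * σ ^ 2) with hb
  have hbp : 0 < b := by positivity
  set κ : ℝ := ((2 * Real.pi * σ ^ 2) ^ ((m + 1) ^ 2))⁻¹ with hκ
  have hκp : 0 < κ := by positivity
  let D : (Fin (m + 1) → Fin (m + 1) → ℂ) → ℝ := fun A =>
    ‖(Matrix.of A).det‖ ^ 2 * Real.exp (-b * ∑ i, ∑ j, ‖A i j - Abar i j‖ ^ 2)
  have hD : ∀ A : Fin (m + 1) → Fin (m + 1) → ℂ,
      ‖(Matrix.of A).det‖ ^ 2 * matrixGaussianDensity Abar σ A = κ * D A := by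
    intro A
    simp only [D, matrixGaussianDensity]
    rw [show -(∑ i, ∑ j, ‖A i j - Abar i j‖ ^ 2) / (2 * σ ^ 2)
      = -b * ∑ i, ∑ j, ‖A i j - Abar i j‖ ^ 2 by rw [hb]; ring]
    ring
  have hDi : Integrable D := aux_integrable b hbp Abar
  have hDn : ∀ A, 0 ≤ D A := fun A => by positivity
  have hDe : ∀ A, ENNReal.ofReal (D A) =
      ENNReal.ofReal (‖(Matrix.of A).det‖ ^ 2) * auxGm b Abar A := by
    intro A
    simp only [D, auxGm, auxNsq, Pi.sub_apply]
    rw [ENNReal.ofReal_mul (by positivity)]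
  simp only [hD, integral_const_mul]
  rw [mul_left_comm]
  refine mul_le_mul_of_nonneg_left ?_ hκp.le
  have hmain := aux_main b t hbp ht Abar
  simp only [← hDe] at hmain
  rw [← ofReal_integral_eq_lintegral_ofReal hDi (Filter.Eventually.of_forall hDn),
    ← ofReal_integral_eq_lintegral_ofReal hDi.integrableOn (Filter.Eventually.of_forall hDn),
    ← ENNReal.ofReal_mul (by positivity)] at hmain
  have hI : 0 ≤ ∫ A, D A := integral_nonneg hDn
  rw [ENNReal.ofReal_le_ofReal_iff (by positivity)] at hmain
  refine hmain.trans (mul_le_mul_of_nonneg_right ?_ hI)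
  have e1 : Real.exp 1 ^ 2 = Real.exp 2 := by rw [← Real.exp_nat_mul]; norm_num
  rw [e1, hb]
  have e2 : Real.exp 2 * ((1 / (2 * σ ^ 2)) ^ 2 * ((m : ℝ) + 1) ^ 2 / (4 * t ^ 4))
      = Real.exp 2 * ((m : ℝ) + 1) ^ 2 / (16 * σ ^ 4 * t ^ 4) := by
    field_simp
    ring
  rw [e2]
  push_cast
  gcongr
  linarith
end

section
/- Let n ≥ 1, fix u ∈ ℂⁿ with ‖u‖ = 1, let 0 ≤ s ≤ 1, and let v be drawn uniformly at random from the unit sphere {v ∈ ℂⁿ : ‖v‖ = 1}. Then the probability that |uᵀv| ≥ s equals (1 − s²)^{n−1}, where uᵀv = Σᵢ uᵢvᵢ. -/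
open MeasureTheory

noncomputable instance (n : ℕ) : MeasurableSpace (EuclideanSpace ℂ (Fin n)) := borel _
instance (n : ℕ) : BorelSpace (EuclideanSpace ℂ (Fin n)) := ⟨rfl⟩

/-- The uniform probability measure on the unit sphere of `ℂⁿ` (with its Euclidean structure),
obtained by normalizing the canonical sphere measure induced by the Lebesgue measure. -/
noncomputable def uniformSphereMeasure (n : ℕ) :
    Measure (Metric.sphere (0 : EuclideanSpace ℂ (Fin n)) 1) :=
  ((volume : Measure (EuclideanSpace ℂ (Fin n))).toSphere Set.univ)⁻¹ •
    (volume : Measure (EuclideanSpace ℂ (Fin n))).toSphere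

section Helpers
open Set Metric

/-- Polar decomposition of the Gaussian weight of a cone. -/
theorem cone_gauss {E : Type*} [NormedAddCommGroup E] [NormedSpace ℝ E] [MeasurableSpace E]
    [BorelSpace E] [FiniteDimensional ℝ E] [Nontrivial E] (μ : Measure E) [μ.IsAddHaarMeasure]
    (A : Set (sphere (0 : E) 1)) (hA : MeasurableSet A) (C : Set E) (hC : MeasurableSet C)
    (h : ∀ x : E, ∀ hx : x ≠ 0, x ∈ C ↔ (homeomorphUnitSphereProd E ⟨x, hx⟩).1 ∈ A) :
    ∫⁻ x in C, ENNReal.ofReal (Real.exp (-‖x‖ ^ 2)) ∂μ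
      = μ.toSphere A * ∫⁻ r : Ioi (0 : ℝ), ENNReal.ofReal (Real.exp (-(r : ℝ) ^ 2))
          ∂(Measure.volumeIoiPow (Module.finrank ℝ E - 1)) := by
  rw [← lintegral_indicator hC]
  calc _ = ∫⁻ x in ({0}ᶜ : Set E), C.indicator
            (fun x => ENNReal.ofReal (Real.exp (-‖x‖ ^ 2))) x ∂μ := by
          rw [restrict_compl_singleton]
    _ = ∫⁻ x : ({0}ᶜ : Set E), C.indicator
            (fun x => ENNReal.ofReal (Real.exp (-‖x‖ ^ 2))) x ∂(μ.comap (↑)) := by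
          rw [lintegral_subtype_comap (measurableSet_singleton _).compl]
    _ = ∫⁻ p, A.indicator 1 p.1 * ENNReal.ofReal (Real.exp (-(p.2 : ℝ) ^ 2))
          ∂(μ.toSphere.prod (Measure.volumeIoiPow (Module.finrank ℝ E - 1))) := by
          rw [← μ.measurePreserving_homeomorphUnitSphereProd.lintegral_comp_emb
            (Homeomorph.measurableEmbedding _)]
          refine lintegral_congr fun x => ?_
          have hx := h x.1 x.2
          by_cases hc : x.1 ∈ C
          · have := hx.1 hc
            simp [hc, this]
          · have := mt hx.2 hc
            simp [hc, this]
    _ = _ := by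
          have := lintegral_prod_mul (μ := μ.toSphere)
            (ν := Measure.volumeIoiPow (Module.finrank ℝ E - 1)) (f := A.indicator 1)
            (g := fun r => ENNReal.ofReal (Real.exp (-(r : ℝ) ^ 2)))
            (measurable_one.indicator hA).aemeasurable (by fun_prop)
          rw [this, lintegral_indicator_one hA]

theorem gauss_integrable {E : Type*} [NormedAddCommGroup E] [InnerProductSpace ℝ E]
    [MeasurableSpace E] [BorelSpace E] [FiniteDimensional ℝ E] :
    Integrable (fun x : E => Real.exp (-‖x‖ ^ 2)) ∧ 0 < ∫ x : E, Real.exp (-‖x‖ ^ 2) := by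
  have h := GaussianFourier.integral_rexp_neg_mul_sq_norm (V := E) one_pos
  simp only [neg_mul, one_mul] at h
  have hp : 0 < ∫ x : E, Real.exp (-‖x‖ ^ 2) := by
    rw [h]; positivity
  exact ⟨Integrable.of_integral_ne_zero hp.ne', hp⟩

theorem planar_gauss : ∃ K : ENNReal, ∀ t : ℝ, 0 ≤ t →
    ∫⁻ z : ℂ in {z | t ≤ ‖z‖ ^ 2}, ENNReal.ofReal (Real.exp (-‖z‖ ^ 2))
      = K * ENNReal.ofReal (Real.exp (-t)) := by
  refine ⟨ENNReal.ofReal ((volume : Measure ℂ).real (ball 0 1)), fun t ht => ?_⟩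
  have hm : MeasurableSet {z : ℂ | t ≤ ‖z‖ ^ 2} := measurableSet_le (by fun_prop) (by fun_prop)
  rw [← ofReal_integral_eq_lintegral_ofReal (gauss_integrable.1.integrableOn)
    (Filter.Eventually.of_forall fun _ => (Real.exp_pos _).le),
    ← ENNReal.ofReal_mul measureReal_nonneg, ← integral_indicator hm]
  congr 1
  have h1 := integral_fun_norm_addHaar (volume : Measure ℂ)
    ((Ici (√t)).indicator fun r => Real.exp (-r ^ 2))
  have h2 : ∀ z : ℂ, ({z : ℂ | t ≤ ‖z‖ ^ 2}.indicator (fun z => Real.exp (-‖z‖ ^ 2)) z)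
      = (Ici (√t)).indicator (fun r => Real.exp (-r ^ 2)) ‖z‖ := by
    intro z
    simp only [indicator, mem_ofPred_eq, mem_Ici, Real.sqrt_le_left (norm_nonneg z)]
  simp_rw [h2, h1, Complex.finrank_real_complex]
  have h3 : ∀ y : ℝ, y ^ (2 - 1) • (Ici (√t)).indicator (fun r => Real.exp (-r ^ 2)) y
      = (Ici (√t)).indicator (fun r => r * Real.exp (-r ^ 2)) y := by
    intro y
    simp only [indicator]
    split_ifs <;> simp
  have h4 : (Ioi 0 ∩ Ici (√t) : Set ℝ) =ᵐ[volume] Ioi (√t) := by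
    have := (Filter.EventuallyEq.refl (ae (volume : Measure ℝ)) (Ioi (0 : ℝ))).inter
      (Ioi_ae_eq_Ici (μ := (volume : Measure ℝ)) (a := √t)).symm
    refine this.trans ?_
    rw [Ioi_inter_Ioi, max_eq_right (Real.sqrt_nonneg t)]
    exact Filter.EventuallyEq.rfl
  have h5 : ∫ r in Ioi (√t), r * Real.exp (-r ^ 2) = Real.exp (-t) / 2 := by
    have hd : ∀ x : ℝ, HasDerivAt (fun r => -(Real.exp (-r ^ 2) / 2)) (x * Real.exp (-x ^ 2)) x := by
      intro x
      have := (((hasDerivAt_pow 2 x).neg.exp).div_const 2).neg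
      refine HasDerivAt.congr_deriv this ?_
      simp only [Pi.neg_apply]
      push_cast
      ring
    have := integral_Ioi_of_hasDerivAt_of_nonneg' (a := √t) (l := 0) (fun x _ => hd x)
      (fun x hx => mul_nonneg ((Real.sqrt_nonneg t).trans (le_of_lt hx)) (Real.exp_pos _).le) (by
        have h0 : Filter.Tendsto (fun r : ℝ => Real.exp (-r ^ 2)) Filter.atTop (nhds 0) :=
          Real.tendsto_exp_neg_atTop_nhds_zero.comp (Filter.tendsto_pow_atTop two_ne_zero)
        simpa using (h0.div_const 2).neg)
    rw [this, Real.sq_sqrt ht]; ring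
  simp_rw [h3]
  rw [setIntegral_indicator measurableSet_Ici, setIntegral_congr_set h4, h5]
  simp
  ring

theorem gauss_scale {F : Type*} [NormedAddCommGroup F] [NormedSpace ℝ F] [MeasurableSpace F]
    [BorelSpace F] [FiniteDimensional ℝ F] (μ : Measure F) [μ.IsAddHaarMeasure] (a : ℝ) (ha : 0 < a) :
    ∫⁻ y, ENNReal.ofReal (Real.exp (-(‖y‖ / a) ^ 2)) ∂μ
     = ENNReal.ofReal (a ^ Module.finrank ℝ F) * ∫⁻ y, ENNReal.ofReal (Real.exp (-‖y‖ ^ 2)) ∂μ := by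
  have h := Measure.map_addHaar_smul μ (r := a⁻¹) (by positivity)
  have h2 : ∫⁻ y, ENNReal.ofReal (Real.exp (-‖y‖ ^ 2)) ∂(μ.map (fun x => a⁻¹ • x))
     = ∫⁻ y, ENNReal.ofReal (Real.exp (-(‖y‖ / a) ^ 2)) ∂μ := by
    rw [lintegral_map (by fun_prop) (by fun_prop)]
    refine lintegral_congr fun y => ?_
    rw [norm_smul, Real.norm_of_nonneg (by positivity), div_eq_inv_mul]
  rw [← h2, h, lintegral_smul_measure, smul_eq_mul]
  congr 2
  rw [inv_pow, inv_inv, abs_of_pos (by positivity)]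

theorem prod_gauss {F : Type*} [NormedAddCommGroup F] [NormedSpace ℝ F] [MeasurableSpace F]
    [BorelSpace F] [FiniteDimensional ℝ F] (μ : Measure F) [μ.IsAddHaarMeasure]
    (K : ENNReal) (hK : ∀ t : ℝ, 0 ≤ t →
      ∫⁻ z : ℂ in {z | t ≤ ‖z‖ ^ 2}, ENNReal.ofReal (Real.exp (-‖z‖ ^ 2))
        = K * ENNReal.ofReal (Real.exp (-t)))
    (s : ℝ) (hs0 : 0 ≤ s) (hs1 : s < 1) :
    ∫⁻ p in {p : ℂ × F | s ^ 2 * (‖p.1‖ ^ 2 + ‖p.2‖ ^ 2) ≤ ‖p.1‖ ^ 2},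
        ENNReal.ofReal (Real.exp (-(‖p.1‖ ^ 2 + ‖p.2‖ ^ 2))) ∂((volume : Measure ℂ).prod μ)
      = ENNReal.ofReal (√(1 - s ^ 2) ^ Module.finrank ℝ F) *
        (K * ∫⁻ y, ENNReal.ofReal (Real.exp (-‖y‖ ^ 2)) ∂μ) := by
  have hpos : 0 < 1 - s ^ 2 := by nlinarith
  have hm : MeasurableSet {p : ℂ × F | s ^ 2 * (‖p.1‖ ^ 2 + ‖p.2‖ ^ 2) ≤ ‖p.1‖ ^ 2} :=
    measurableSet_le (by fun_prop) (by fun_prop)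
  rw [← lintegral_indicator hm, lintegral_prod_symm _ (by
    refine (Measurable.indicator ?_ hm).aemeasurable
    fun_prop)]
  rw [mul_left_comm, ← gauss_scale μ _ (Real.sqrt_pos.2 hpos), ← lintegral_const_mul _ (by fun_prop)]
  refine lintegral_congr fun y => ?_
  have hy : (‖y‖ / √(1 - s ^ 2)) ^ 2 = ‖y‖ ^ 2 + s ^ 2 / (1 - s ^ 2) * ‖y‖ ^ 2 := by
    rw [div_pow, Real.sq_sqrt hpos.le]; field_simp; ring
  rw [hy, neg_add, Real.exp_add, ENNReal.ofReal_mul (Real.exp_pos _).le, mul_left_comm,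
    ← hK _ (by positivity), ← lintegral_const_mul _ (by fun_prop),
    ← lintegral_indicator (measurableSet_le (by fun_prop) (by fun_prop))]
  refine lintegral_congr fun z => ?_
  have hiff : s ^ 2 * (‖z‖ ^ 2 + ‖y‖ ^ 2) ≤ ‖z‖ ^ 2 ↔ s ^ 2 / (1 - s ^ 2) * ‖y‖ ^ 2 ≤ ‖z‖ ^ 2 := by
    rw [div_mul_eq_mul_div, div_le_iff₀ hpos]
    constructor <;> intro h <;> nlinarith
  simp only [indicator, mem_ofPred_eq, hiff]
  split_ifs
  · rw [← ENNReal.ofReal_mul (Real.exp_pos _).le, ← Real.exp_add]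
    congr 2; ring
  · rfl

theorem exists_split {n : ℕ} (w : EuclideanSpace ℂ (Fin n)) (hw : ‖w‖ = 1) :
    ∃ φ : EuclideanSpace ℂ (Fin n) ≃ₗ[ℝ] ℂ × (Submodule.span ℂ {w})ᗮ,
      ∀ x, (φ x).1 = inner ℂ w x ∧ ‖x‖ ^ 2 = ‖(φ x).1‖ ^ 2 + ‖(φ x).2‖ ^ 2 := by
  have hww : inner ℂ w w = (1 : ℂ) := by
    rw [inner_self_eq_norm_sq_to_K, hw]; simp
  have hmem : ∀ x, x - (inner ℂ w x : ℂ) • w ∈ (Submodule.span ℂ {w})ᗮ := by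
    intro x
    rw [Submodule.mem_orthogonal_singleton_iff_inner_right, inner_sub_right, inner_smul_right, hww]
    simp
  refine ⟨{ toFun := fun x => (inner ℂ w x, ⟨x - (inner ℂ w x : ℂ) • w, hmem x⟩)
            map_add' := ?_
            map_smul' := ?_
            invFun := fun p => p.1 • w + p.2
            left_inv := ?_
            right_inv := ?_ }, ?_⟩
  · intro x y
    ext1
    · simp
    · apply Subtype.ext
      simp only [inner_add_right, add_smul, Prod.snd_add, Submodule.coe_add]
      abel
  · intro r x
    have : (inner ℂ w (r • x) : ℂ) = r • inner ℂ w x := by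
      rw [← Complex.coe_smul, inner_smul_right]; simp
    ext1
    · simp [this]
    · apply Subtype.ext
      simp only [this, smul_assoc, Prod.smul_snd, RingHom.id_apply]
      exact (smul_sub r x _).symm
  · intro x
    simp
  · rintro ⟨z, y, hy⟩
    rw [Submodule.mem_orthogonal_singleton_iff_inner_right] at hy
    ext1
    · simp [hw, hy]
    · apply Subtype.ext
      simp [hw, hy]
  · intro x
    refine ⟨rfl, ?_⟩
    have h0 := hmem x
    rw [Submodule.mem_orthogonal_singleton_iff_inner_right] at h0
    have h := norm_add_sq_eq_norm_sq_add_norm_sq_of_inner_eq_zero (𝕜 := ℂ)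
      ((inner ℂ w x : ℂ) • w) (x - (inner ℂ w x : ℂ) • w) (by rw [inner_smul_left, h0, mul_zero])
    rw [add_sub_cancel, norm_smul, hw, mul_one] at h
    simp only [LinearEquiv.coe_mk, LinearMap.coe_mk, AddHom.coe_mk, Submodule.coe_norm, sq]
    exact h

theorem cone_ratio {n : ℕ} (hn : 1 ≤ n) (w : EuclideanSpace ℂ (Fin n)) (hw : ‖w‖ = 1)
    (s : ℝ) (hs0 : 0 ≤ s) (hs1 : s < 1) :
    ∫⁻ x : EuclideanSpace ℂ (Fin n) in {x | s * ‖x‖ ≤ ‖(inner ℂ w x : ℂ)‖},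
        ENNReal.ofReal (Real.exp (-‖x‖ ^ 2))
      = ENNReal.ofReal ((1 - s ^ 2) ^ (n - 1)) *
        ∫⁻ x : EuclideanSpace ℂ (Fin n), ENNReal.ofReal (Real.exp (-‖x‖ ^ 2)) := by
  obtain ⟨φ, hφ⟩ := exists_split w hw
  obtain ⟨K, hK⟩ := planar_gauss
  let F := (Submodule.span ℂ {w})ᗮ
  let _ : MeasurableSpace F := borel F
  have : BorelSpace F := ⟨rfl⟩
  have hdim : Module.finrank ℝ F = 2 * (n - 1) := by
    have h := φ.finrank_eq
    rw [Module.finrank_prod, Complex.finrank_real_complex] at h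
    have h2 : Module.finrank ℝ (EuclideanSpace ℂ (Fin n)) = 2 * n := by
      rw [(WithLp.linearEquiv 2 ℝ (Fin n → ℂ)).finrank_eq, Module.finrank_pi_fintype]
      simp [Complex.finrank_real_complex, mul_comm]
    change _ = 2 + Module.finrank ℝ F at h
    omega
  have : FiniteDimensional ℝ (ℂ × F) := Module.Finite.equiv φ
  have : FiniteDimensional ℝ F := Module.Finite.of_surjective (LinearMap.snd ℝ ℂ F)
    LinearMap.snd_surjective
  let ψ : EuclideanSpace ℂ (Fin n) ≃L[ℝ] ℂ × F := φ.toContinuousLinearEquiv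
  have hψ : ∀ x, (ψ x).1 = inner ℂ w x ∧ ‖x‖ ^ 2 = ‖(ψ x).1‖ ^ 2 + ‖(ψ x).2‖ ^ 2 := hφ
  let μ : Measure F := Measure.addHaar
  let ν := (volume : Measure (EuclideanSpace ℂ (Fin n))).map ψ
  have : ν.IsAddHaarMeasure := ψ.isAddHaarMeasure_map _
  obtain ⟨c, hc⟩ : ∃ c : NNReal, ν = c • ((volume : Measure ℂ).prod μ) :=
    ⟨_, Measure.isAddLeftInvariant_eq_smul _ _⟩
  have key : ∀ s : ℝ, 0 ≤ s → s < 1 →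
      ∫⁻ x : EuclideanSpace ℂ (Fin n) in {x | s * ‖x‖ ≤ ‖(inner ℂ w x : ℂ)‖},
        ENNReal.ofReal (Real.exp (-‖x‖ ^ 2))
      = ENNReal.ofReal ((1 - s ^ 2) ^ (n - 1)) * (c *
        (K * ∫⁻ y, ENNReal.ofReal (Real.exp (-‖y‖ ^ 2)) ∂μ)) := by
    intro s hs0 hs1
    have h := prod_gauss μ K hK s hs0 hs1
    have hp : 0 ≤ 1 - s ^ 2 := by nlinarith
    rw [hdim, pow_mul, Real.sq_sqrt hp] at h
    rw [mul_left_comm, ← h]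
    have hm : MeasurableSet {p : ℂ × F | s ^ 2 * (‖p.1‖ ^ 2 + ‖p.2‖ ^ 2) ≤ ‖p.1‖ ^ 2} :=
      measurableSet_le (by fun_prop) (by fun_prop)
    have h2 : ∫⁻ p in {p : ℂ × F | s ^ 2 * (‖p.1‖ ^ 2 + ‖p.2‖ ^ 2) ≤ ‖p.1‖ ^ 2},
        ENNReal.ofReal (Real.exp (-(‖p.1‖ ^ 2 + ‖p.2‖ ^ 2))) ∂ν =
        c * ∫⁻ p in {p : ℂ × F | s ^ 2 * (‖p.1‖ ^ 2 + ‖p.2‖ ^ 2) ≤ ‖p.1‖ ^ 2},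
        ENNReal.ofReal (Real.exp (-(‖p.1‖ ^ 2 + ‖p.2‖ ^ 2))) ∂((volume : Measure ℂ).prod μ) := by
      rw [hc, Measure.restrict_smul, lintegral_smul_measure]; rfl
    rw [← h2, setLIntegral_map hm (by fun_prop) ψ.continuous.measurable]
    have hset : ψ ⁻¹' {p : ℂ × F | s ^ 2 * (‖p.1‖ ^ 2 + ‖p.2‖ ^ 2) ≤ ‖p.1‖ ^ 2}
        = {x | s * ‖x‖ ≤ ‖(inner ℂ w x : ℂ)‖} := by
      ext x
      simp only [mem_preimage, mem_ofPred_eq]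
      rw [← (hψ x).2, (hψ x).1, ← mul_pow, sq_le_sq₀ (by positivity) (by positivity)]
    rw [hset]
    refine lintegral_congr fun x => ?_
    rw [← (hψ x).2]
  have k0 := key 0 le_rfl one_pos
  simp only [zero_mul, norm_nonneg, ofPred_true, Measure.restrict_univ] at k0
  rw [key s hs0 hs1, k0]
  simp

theorem sphere_lt_one {n : ℕ} (hn : 1 ≤ n)
    (u : EuclideanSpace ℂ (Fin n)) (hu : ‖u‖ = 1) (s : ℝ) (hs0 : 0 ≤ s) (hs1 : s < 1) :
    uniformSphereMeasure n
        {v : Metric.sphere (0 : EuclideanSpace ℂ (Fin n)) 1 |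
          s ≤ ‖∑ i, u i * (v : EuclideanSpace ℂ (Fin n)) i‖}
      = ENNReal.ofReal ((1 - s ^ 2) ^ (n - 1)) := by
  let w : EuclideanSpace ℂ (Fin n) := WithLp.toLp 2 fun i => (starRingEnd ℂ) (u i)
  have hw : ‖w‖ = 1 := by
    rw [← hu, EuclideanSpace.norm_eq, EuclideanSpace.norm_eq]
    simp [w]
  have hin : ∀ x : EuclideanSpace ℂ (Fin n), (inner ℂ w x : ℂ) = ∑ i, u i * x i := by
    intro x
    simp [w, PiLp.inner_apply, mul_comm]
  have : Nontrivial (EuclideanSpace ℂ (Fin n)) := ⟨u, 0, by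
    rintro rfl
    simp at hu⟩
  simp only [← hin]
  set A := {v : Metric.sphere (0 : EuclideanSpace ℂ (Fin n)) 1 |
    s ≤ ‖(inner ℂ w (v : EuclideanSpace ℂ (Fin n)) : ℂ)‖} with hAdef
  have hA : MeasurableSet A := by
    refine IsClosed.measurableSet (isClosed_le continuous_const ?_)
    fun_prop
  have hC : MeasurableSet {x : EuclideanSpace ℂ (Fin n) | s * ‖x‖ ≤ ‖(inner ℂ w x : ℂ)‖} := by
    refine IsClosed.measurableSet (isClosed_le ?_ ?_) <;> fun_prop
  let σ := (volume : Measure (EuclideanSpace ℂ (Fin n))).toSphere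
  have e1 := cone_gauss (volume : Measure (EuclideanSpace ℂ (Fin n))) A hA _ hC (by
    intro x hx
    have hx' : 0 < ‖x‖ := norm_pos_iff.2 hx
    have hn' : ‖(inner ℂ w (‖x‖⁻¹ • x) : ℂ)‖ = ‖x‖⁻¹ * ‖(inner ℂ w x : ℂ)‖ := by
      rw [← Complex.coe_smul, inner_smul_right]; simp
    simp only [hAdef, mem_ofPred_eq, homeomorphUnitSphereProd_apply_fst_coe, hn']
    rw [inv_mul_eq_div, le_div_iff₀ hx'])
  have e2 := cone_gauss (volume : Measure (EuclideanSpace ℂ (Fin n))) univ .univ univ .univ (by simp)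
  rw [Measure.restrict_univ] at e2
  rw [cone_ratio hn w hw s hs0 hs1] at e1
  obtain ⟨hi, hpos⟩ := gauss_integrable (E := EuclideanSpace ℂ (Fin n))
  have hT : ∫⁻ x : EuclideanSpace ℂ (Fin n), ENNReal.ofReal (Real.exp (-‖x‖ ^ 2))
      = ENNReal.ofReal (∫ x : EuclideanSpace ℂ (Fin n), Real.exp (-‖x‖ ^ 2)) :=
    (ofReal_integral_eq_lintegral_ofReal hi
      (Filter.Eventually.of_forall fun _ => (Real.exp_pos _).le)).symm
  have hT0 : ENNReal.ofReal (∫ x : EuclideanSpace ℂ (Fin n), Real.exp (-‖x‖ ^ 2)) ≠ 0 := by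
    simpa using hpos
  rw [hT] at e1 e2
  set T := ENNReal.ofReal (∫ x : EuclideanSpace ℂ (Fin n), Real.exp (-‖x‖ ^ 2)) with hTdef
  have hTt : T ≠ ⊤ := ENNReal.ofReal_ne_top
  clear_value T
  set R := ∫⁻ r : Ioi (0 : ℝ), ENNReal.ofReal (Real.exp (-(r : ℝ) ^ 2))
          ∂(Measure.volumeIoiPow (Module.finrank ℝ (EuclideanSpace ℂ (Fin n)) - 1))
  have hU0 : (volume : Measure (EuclideanSpace ℂ (Fin n))).toSphere univ ≠ 0 := by
    intro h; rw [h, zero_mul] at e2; exact hT0 e2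
  have hUt : (volume : Measure (EuclideanSpace ℂ (Fin n))).toSphere univ ≠ ⊤ := measure_ne_top _ _
  have hR0 : R ≠ 0 := by
    intro h; rw [h, mul_zero] at e2; exact hT0 e2
  have hRt : R ≠ ⊤ := by
    intro h; rw [h, ENNReal.mul_top hU0] at e2; exact hTt e2
  rw [e2, ← mul_assoc] at e1
  have e3 := (ENNReal.mul_left_inj hR0 hRt).1 e1
  simp only [uniformSphereMeasure, Measure.smul_apply, smul_eq_mul]
  rw [← e3, mul_left_comm, ENNReal.inv_mul_cancel hU0 hUt, mul_one]
end Helpers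

/-- Lemma `le:tvb`: for a fixed unit vector `u ∈ ℂⁿ`, `0 ≤ s ≤ 1`, and `v` uniformly
distributed on the unit sphere of `ℂⁿ`, the probability that `|uᵀv| ≥ s` equals
`(1 - s²)^(n-1)`, where `uᵀv = Σᵢ uᵢ vᵢ` (bilinear pairing, no conjugation). -/
theorem prob_bilinear_pairing_ge (n : ℕ) (hn : 1 ≤ n)
    (u : EuclideanSpace ℂ (Fin n)) (hu : ‖u‖ = 1) (s : ℝ) (hs0 : 0 ≤ s) (hs1 : s ≤ 1) :
    uniformSphereMeasure n
        {v : Metric.sphere (0 : EuclideanSpace ℂ (Fin n)) 1 |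
          s ≤ ‖∑ i, u i * (v : EuclideanSpace ℂ (Fin n)) i‖}
      = ENNReal.ofReal ((1 - s ^ 2) ^ (n - 1)) := by

  rcases hs1.lt_or_eq with h | rfl
  · exact sphere_lt_one hn u hu s hs0 h
  rcases hn.eq_or_lt with rfl | hn2
  · have hset : {v : Metric.sphere (0 : EuclideanSpace ℂ (Fin 1)) 1 |
        (1 : ℝ) ≤ ‖∑ i, u i * (v : EuclideanSpace ℂ (Fin 1)) i‖} =
        {v : Metric.sphere (0 : EuclideanSpace ℂ (Fin 1)) 1 |
        (0 : ℝ) ≤ ‖∑ i, u i * (v : EuclideanSpace ℂ (Fin 1)) i‖} := by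
      ext v
      have hv : ‖(v : EuclideanSpace ℂ (Fin 1))‖ = 1 := by simp
      rw [EuclideanSpace.norm_eq] at hu hv
      simp at hu hv
      simp [hu, hv]
    rw [hset, sphere_lt_one le_rfl u hu 0 le_rfl one_pos]
    simp
  · have hle : ∀ t : ℝ, 0 ≤ t → t < 1 → uniformSphereMeasure n
        {v : Metric.sphere (0 : EuclideanSpace ℂ (Fin n)) 1 |
          (1 : ℝ) ≤ ‖∑ i, u i * (v : EuclideanSpace ℂ (Fin n)) i‖}
        ≤ ENNReal.ofReal ((1 - t ^ 2) ^ (n - 1)) := by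
      intro t ht0 ht1
      rw [← sphere_lt_one hn u hu t ht0 ht1]
      exact measure_mono fun v hv => ht1.le.trans hv
    have hlim : Filter.Tendsto (fun t : ℝ => ENNReal.ofReal ((1 - t ^ 2) ^ (n - 1)))
        (nhdsWithin 1 (Set.Iio 1)) (nhds (ENNReal.ofReal ((1 - 1 ^ 2) ^ (n - 1)))) := by
      have : Continuous (fun t : ℝ => ENNReal.ofReal ((1 - t ^ 2) ^ (n - 1))) :=
        ENNReal.continuous_ofReal.comp (by fun_prop)
      exact (this.tendsto 1).mono_left nhdsWithin_le_nhds
    have h := ge_of_tendsto hlim (by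
      filter_upwards [Ioo_mem_nhdsLT (show (0 : ℝ) < 1 by norm_num)] with t ht
      exact hle t ht.1.le ht.2)
    refine le_antisymm h ?_
    have h0 : n - 1 ≠ 0 := by omega
    simp [h0]
end
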